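/- arXiv:2205.08415 — 5 statements merged into one kernel-verified Lean document; each statement's English description precedes it below -/
import Mathlib

section
/- Assume A satisfies condition (103) with lim_{p→∞} pA(p) < ∞, and f satisfies condition (117): f : ℝ → (0,∞) is continuous and monotone non-decreasing on all of ℝ. Then the generalized Hessian inequality (101), σ_k(λ(D_i(A(|Du|)D_j u)))^{1/k} ≥ f(u) in ℝ^n, has no solution u ∈ C²(ℝ^n∖{0}) ∩ Φ^k(ℝ^n) (not necessarily positive). -/
open Filter MeasureTheory Set Topology
open scoped ENNReal

noncomputable section

abbrev Euc (n : ℕ) := EuclideanSpace ℝ (Fin n)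

/-- k-th elementary symmetric function of λ ∈ ℝⁿ. -/
def sigmaElem (n k : ℕ) (lam : Fin n → ℝ) : ℝ :=
  ∑ S ∈ Finset.powersetCard k (Finset.univ : Finset (Fin n)), ∏ i ∈ S, lam i

/-- The cone Γ_k. -/
def GammaK (n k : ℕ) : Set (Fin n → ℝ) :=
  {lam | ∀ l, 1 ≤ l → l ≤ k → 0 < sigmaElem n l lam}

/-- Matrix (D_i V_j) of a vector field V. -/
def jacMatrix {n : ℕ} (V : Euc n → Euc n) (x : Euc n) : Matrix (Fin n) (Fin n) ℝ :=
  fun i j => fderiv ℝ (fun y => V y j) x (EuclideanSpace.single i 1)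

/-- Condition (103). -/
def Cond103 (A : ℝ → ℝ) : Prop :=
  ContDiffOn ℝ 1 A (Ioi 0) ∧ (∀ p ∈ Ioi (0:ℝ), 0 < A p) ∧
  ContinuousOn (fun p => p * A p) (Ici 0) ∧
  StrictMonoOn (fun p => p * A p) (Ioi 0)

/-- Condition (109). -/
def Cond109 (f : ℝ → ℝ) : Prop :=
  ContinuousOn f (Ioi 0) ∧ (∀ t ∈ Ioi (0:ℝ), 0 < f t) ∧ MonotoneOn f (Ioi 0)

/-- Condition (117). -/
def Cond117 (f : ℝ → ℝ) : Prop :=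
  Continuous f ∧ (∀ t, 0 < f t) ∧ Monotone f

/-- Condition (108): 0 < liminf A(p)/p^{m-2} ≤ limsup A(p)/p^{m-2} < ∞. -/
def Cond108 (A : ℝ → ℝ) (m : ℝ) : Prop :=
  ∃ c₁ c₂ : ℝ, 0 < c₁ ∧
    ∀ᶠ p in atTop, c₁ ≤ A p / p ^ (m - 2) ∧ A p / p ^ (m - 2) ≤ c₂

/-- u ∈ C²(ℝⁿ \ {0}) ∩ Φᵏ(ℝⁿ) is an entire solution of inequality (101). -/
def IsEntireSol (n k : ℕ) (A f : ℝ → ℝ) (u : Euc n → ℝ) : Prop :=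
  ContDiff ℝ 1 u ∧ ContDiffOn ℝ 2 u {(0 : Euc n)}ᶜ ∧
  ∃ V : Euc n → Euc n, ContDiff ℝ 1 V ∧
    (∀ x, V x = A ‖gradient u x‖ • gradient u x) ∧
    ∃ hsym : ∀ x, (jacMatrix V x).IsHermitian,
      (∀ x, (hsym x).eigenvalues ∈ GammaK n k) ∧
      ∀ x, f (u x) ≤ (sigmaElem n k ((hsym x).eigenvalues)) ^ ((1:ℝ)/k)

/-- Ψ(p) = p (pA(p))^k − ∫₀^p (tA(t))^k dt. -/
def Psi (A : ℝ → ℝ) (k : ℕ) (p : ℝ) : ℝ :=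
  p * (p * A p) ^ k - ∫ t in (0:ℝ)..p, (t * A t) ^ k

/-- Ψ⁻¹, the inverse of Ψ on [0,∞). -/
def PsiInv (A : ℝ → ℝ) (k : ℕ) : ℝ → ℝ :=
  Function.invFunOn (Psi A k) (Ici 0)

/-- Generalized Keller–Osserman condition (110) with lower limit c. -/
def KO (A f : ℝ → ℝ) (k : ℕ) (c : ℝ) : Prop :=
  ∫⁻ s in Ioi c, ENNReal.ofReal (PsiInv A k (∫ t in c..s, f t ^ k))⁻¹ = ⊤

/-- [0,R) with R ∈ [0,∞]. -/
def IcoE (R : ℝ≥0∞) : Set ℝ := {r : ℝ | 0 ≤ r ∧ ENNReal.ofReal r < R}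

/-- (0,R) with R ∈ [0,∞]. -/
def IooE (R : ℝ≥0∞) : Set ℝ := {r : ℝ | 0 < r ∧ ENNReal.ofReal r < R}

/-- φ is a positive solution of the Cauchy problem (204) on [0,R). -/
def IsCauchySol (n k : ℕ) (A f : ℝ → ℝ) (a : ℝ) (R : ℝ≥0∞) (φ : ℝ → ℝ) : Prop :=
  ContinuousOn φ (IcoE R) ∧
  (∀ r ∈ IooE R, DifferentiableAt ℝ φ r) ∧
  ContinuousOn (deriv φ) (IooE R) ∧
  φ 0 = a ∧
  (∀ r ∈ IcoE R, 0 < φ r) ∧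
  ∀ r ∈ IooE R,
    A |deriv φ r| * deriv φ r =
      (n * r ^ ((k:ℝ) - n) / (n.choose k) * ∫ s in (0:ℝ)..r, s ^ (n-1) * f (φ s) ^ k) ^ ((1:ℝ)/k)


theorem sigmaElem_one (n : ℕ) (lam : Fin n → ℝ) : sigmaElem n 1 lam = ∑ i, lam i := by
  simp [sigmaElem, Finset.powersetCard_one]

theorem two_mul_sigmaElem_two (n : ℕ) (lam : Fin n → ℝ) :
    2 * sigmaElem n 2 lam = (∑ i, lam i) ^ 2 - ∑ i, lam i ^ 2 := by
  have h := congrArg (MvPolynomial.eval lam) (MvPolynomial.mul_esymm_eq_sum (Fin n) ℝ 2)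
  have hfil : (Finset.HasAntidiagonal.antidiagonal 2).filter (fun a : ℕ × ℕ => a.1 < 2) =
      ({(0, 2), (1, 1)} : Finset (ℕ × ℕ)) := by
    decide
  rw [hfil] at h
  simp [MvPolynomial.esymm, MvPolynomial.psum, Finset.powersetCard_one] at h
  rw [sigmaElem, h]
  ring

theorem abs_le_sigmaElem_one {n : ℕ} {lam : Fin n → ℝ} (h1 : 0 ≤ sigmaElem n 1 lam)
    (h2 : 0 ≤ sigmaElem n 2 lam) (i : Fin n) : |lam i| ≤ sigmaElem n 1 lam := by
  rw [sigmaElem_one] at *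
  refine abs_le_of_sq_le_sq ?_ h1
  have := two_mul_sigmaElem_two n lam
  have := Finset.single_le_sum (f := fun i => lam i ^ 2) (fun i _ => sq_nonneg _)
    (Finset.mem_univ i)
  linarith

/-- A weak form of Maclaurin's inequality on the cone `Γ_k`. -/
theorem sigmaElem_le_choose_mul_pow {n k : ℕ} (hk : 1 ≤ k) {lam : Fin n → ℝ}
    (h : lam ∈ GammaK n k) : sigmaElem n k lam ≤ n.choose k * sigmaElem n 1 lam ^ k := by
  have h1 : 0 < sigmaElem n 1 lam := h 1 le_rfl hk
  rcases hk.eq_or_lt with rfl | hk2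
  · have hn : 1 ≤ n := by
      by_contra hn
      obtain rfl : n = 0 := by omega
      simp [sigmaElem_one] at h1
    have : (1 : ℝ) ≤ n := by exact_mod_cast hn
    simpa using le_mul_of_one_le_left h1.le this
  · have habs := abs_le_sigmaElem_one h1.le (h 2 (by norm_num) hk2).le
    calc sigmaElem n k lam
        ≤ ∑ S ∈ Finset.powersetCard k (Finset.univ : Finset (Fin n)), sigmaElem n 1 lam ^ k := by
          refine Finset.sum_le_sum fun S hS => ?_
          rw [← (Finset.mem_powersetCard.1 hS).2]
          refine (le_abs_self _).trans ?_
          rw [Finset.abs_prod]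
          exact (Finset.prod_le_prod (fun i _ => abs_nonneg _) fun i _ => habs i).trans_eq
            (Finset.prod_const _)
      _ = n.choose k * sigmaElem n 1 lam ^ k := by
          simp [Finset.card_powersetCard]

theorem sigmaElem_rpow_le {n k : ℕ} (hk : 1 ≤ k) {lam : Fin n → ℝ} (h : lam ∈ GammaK n k) :
    sigmaElem n k lam ^ ((1 : ℝ) / k) ≤ (n.choose k : ℝ) ^ ((1 : ℝ) / k) * sigmaElem n 1 lam := by
  have h1 : 0 < sigmaElem n 1 lam := h 1 le_rfl hk
  have hk0 : k ≠ 0 := by omega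
  calc sigmaElem n k lam ^ ((1 : ℝ) / k)
      ≤ (n.choose k * sigmaElem n 1 lam ^ k) ^ ((1 : ℝ) / k) :=
        Real.rpow_le_rpow (h k hk le_rfl).le (sigmaElem_le_choose_mul_pow hk h) (by positivity)
    _ = _ := by
        rw [Real.mul_rpow (by positivity) (by positivity), one_div,
          Real.pow_rpow_inv_natCast h1.le hk0]

theorem hasDerivAt_max_zero_pow (m : ℕ) (t : ℝ) :
    HasDerivAt (fun t : ℝ => max 0 t ^ (m + 2)) ((m + 2 : ℝ) * max 0 t ^ (m + 1)) t := by
  rcases lt_trichotomy t 0 with ht | rfl | ht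
  · have : (fun t : ℝ => max 0 t ^ (m + 2)) =ᶠ[𝓝 t] fun _ => 0 := by
      filter_upwards [Iio_mem_nhds ht] with s hs
      simp [max_eq_left (le_of_lt (mem_Iio.1 hs))]
    simpa [max_eq_left ht.le] using (hasDerivAt_const t (0 : ℝ)).congr_of_eventuallyEq this
  · rw [hasDerivAt_iff_isLittleO]
    have h : (fun t : ℝ => max 0 t ^ (m + 2)) =O[𝓝 0] fun t : ℝ => t ^ (m + 2) := by
      refine Asymptotics.IsBigO.pow (Asymptotics.IsBigO.of_bound 1 (.of_forall fun s => ?_)) _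
      rw [one_mul, Real.norm_eq_abs, Real.norm_eq_abs, abs_of_nonneg (le_max_left 0 s)]
      exact max_le (abs_nonneg s) (le_abs_self s)
    simpa using h.trans_isLittleO (Asymptotics.isLittleO_pow_id (by omega : 1 < m + 2))
  · have : (fun t : ℝ => max 0 t ^ (m + 2)) =ᶠ[𝓝 t] fun t => t ^ (m + 2) := by
      filter_upwards [Ioi_mem_nhds ht] with s hs
      simp [max_eq_right (le_of_lt (mem_Ioi.1 hs))]
    simpa [max_eq_right ht.le] using (hasDerivAt_pow (m + 2) t).congr_of_eventuallyEq this

theorem contDiff_max_zero_pow (m : ℕ) : ContDiff ℝ 1 fun t : ℝ => max 0 t ^ (m + 2) := by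
  rw [contDiff_one_iff_deriv]
  refine ⟨fun t => (hasDerivAt_max_zero_pow m t).differentiableAt, ?_⟩
  rw [funext fun t => (hasDerivAt_max_zero_pow m t).deriv]
  fun_prop

/-- The cutoff `(1 - |x|² / S⁴)₊ ^ (m + 2)`, supported in the ball of radius `S²`. -/
def cutoff (n m : ℕ) (S : ℝ) (x : Euc n) : ℝ := max 0 (1 - ‖x‖ ^ 2 / S ^ 4) ^ (m + 2)

theorem cutoff_nonneg (n m : ℕ) (S : ℝ) (x : Euc n) : 0 ≤ cutoff n m S x :=
  pow_nonneg (le_max_left _ _) _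

theorem contDiff_cutoff (n m : ℕ) (S : ℝ) : ContDiff ℝ 1 (cutoff n m S) :=
  (contDiff_max_zero_pow m).comp (contDiff_const.sub ((contDiff_norm_sq ℝ).div_const _))

theorem max_zero_eq_zero_of_notMem_closedBall {n : ℕ} {S : ℝ} (hS : 0 < S) {x : Euc n}
    (hx : x ∉ Metric.closedBall (0 : Euc n) (S ^ 2)) : max 0 (1 - ‖x‖ ^ 2 / S ^ 4) = 0 := by
  rw [mem_closedBall_zero_iff, not_le] at hx
  refine max_eq_left (sub_nonpos.2 ((one_le_div (by positivity)).2 ?_))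
  calc S ^ 4 = (S ^ 2) ^ 2 := by ring
    _ ≤ ‖x‖ ^ 2 := by gcongr

theorem hasCompactSupport_cutoff (n m : ℕ) {S : ℝ} (hS : 0 < S) :
    HasCompactSupport (cutoff n m S) :=
  HasCompactSupport.intro (isCompact_closedBall (0 : Euc n) (S ^ 2)) fun x hx => by
    simp [cutoff, max_zero_eq_zero_of_notMem_closedBall hS hx]

theorem cutoff_mono (n m : ℕ) {S : ℝ} (hS : 1 ≤ S) (x : Euc n) :
    cutoff n m 1 x ≤ cutoff n m S x := by
  have h : ‖x‖ ^ 2 / S ^ 4 ≤ ‖x‖ ^ 2 / 1 ^ 4 := by gcongr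
  unfold cutoff
  gcongr

theorem fderiv_cutoff_apply (n m : ℕ) (S : ℝ) (x v : Euc n) :
    fderiv ℝ (cutoff n m S) x v =
      -((m + 2) * max 0 (1 - ‖x‖ ^ 2 / S ^ 4) ^ (m + 1) * (2 * inner ℝ x v / S ^ 4)) := by
  have h1 : HasFDerivAt (fun y : Euc n => ‖y‖ ^ 2) _ x := (hasFDerivAt_id x).norm_sq
  have h2 := (hasDerivAt_max_zero_pow m (1 - ‖x‖ ^ 2 / S ^ 4)).comp_hasFDerivAt x
    ((h1.mul_const (S ^ 4)⁻¹).const_sub 1)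
  have h3 : HasFDerivAt (cutoff n m S) _ x := h2
  rw [h3.fderiv]
  change (m + 2) * max 0 (1 - ‖x‖ ^ 2 / S ^ 4) ^ (m + 1) *
    -((S ^ 4)⁻¹ * (2 • inner ℝ x v)) = _
  rw [two_nsmul]
  ring

theorem pow_le_mul_pow_add_inv_pow (m : ℕ) {S t : ℝ} (hS : 0 < S) (ht : 0 ≤ t) :
    t ^ (m + 1) ≤ S * t ^ (m + 2) + (S ^ (m + 1))⁻¹ := by
  rcases le_total 1 (S * t) with h | h
  · have h1 : t ^ (m + 1) * 1 ≤ t ^ (m + 1) * (S * t) := by gcongr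
    have h2 : 0 ≤ (S ^ (m + 1))⁻¹ := by positivity
    linear_combination h1 + h2
  · have h1 : t ≤ S⁻¹ := by rwa [← one_div, le_div_iff₀' hS]
    have h2 : t ^ (m + 1) ≤ (S ^ (m + 1))⁻¹ := by rw [← inv_pow]; gcongr
    have : 0 ≤ S * t ^ (m + 2) := by positivity
    linarith

theorem neg_fderiv_cutoff_le (n m : ℕ) {S L : ℝ} (hS : 0 < S) {x v : Euc n} (hv : ‖v‖ ≤ L) :
    -fderiv ℝ (cutoff n m S) x v ≤ 2 * (m + 2) * L / S * cutoff n m S x +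
      (Metric.closedBall (0 : Euc n) (S ^ 2)).indicator
        (fun _ => 2 * (m + 2) * L / S ^ (m + 3)) x := by
  have hL : 0 ≤ L := (norm_nonneg v).trans hv
  rw [fderiv_cutoff_apply, neg_neg]
  by_cases hx : x ∈ Metric.closedBall (0 : Euc n) (S ^ 2)
  · rw [indicator_of_mem hx, cutoff]
    have ht : 0 ≤ max 0 (1 - ‖x‖ ^ 2 / S ^ 4) := le_max_left _ _
    generalize max 0 (1 - ‖x‖ ^ 2 / S ^ 4) = t at ht
    have hin : inner ℝ x v ≤ S ^ 2 * L :=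
      (real_inner_le_norm x v).trans
        (mul_le_mul (mem_closedBall_zero_iff.1 hx) hv (norm_nonneg _) (by positivity))
    calc (m + 2) * t ^ (m + 1) * (2 * inner ℝ x v / S ^ 4)
        ≤ (m + 2) * t ^ (m + 1) * (2 * (S ^ 2 * L) / S ^ 4) := by gcongr
      _ = 2 * (m + 2) * L / S ^ 2 * t ^ (m + 1) := by field_simp
      _ ≤ 2 * (m + 2) * L / S ^ 2 * (S * t ^ (m + 2) + (S ^ (m + 1))⁻¹) := by
          gcongr
          exact pow_le_mul_pow_add_inv_pow m hS ht
      _ = _ := by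
          rw [show S ^ (m + 3) = S ^ (m + 1) * S ^ 2 from pow_add S (m + 1) 2]
          field_simp
  · rw [indicator_of_notMem hx, cutoff, max_zero_eq_zero_of_notMem_closedBall hS hx]
    simp

theorem fderiv_apply_eq_sum {n : ℕ} (F : Euc n → ℝ) (x v : Euc n) :
    fderiv ℝ F x v = ∑ i, fderiv ℝ F x (EuclideanSpace.single i 1) * v i := by
  conv_lhs => rw [← (EuclideanSpace.basisFun (Fin n) ℝ).sum_repr v]
  simp [map_sum, mul_comm]

/-- The divergence theorem, tested against a compactly supported function. -/
theorem integral_mul_trace_jacMatrix {n : ℕ} {F : Euc n → ℝ} {V : Euc n → Euc n}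
    (hF : ContDiff ℝ 1 F) (hFc : HasCompactSupport F) (hV : ContDiff ℝ 1 V) :
    ∫ x, F x * (jacMatrix V x).trace = -∫ x, fderiv ℝ F x (V x) := by
  have hVi (i : Fin n) : ContDiff ℝ 1 fun y => V y i := by fun_prop
  have hdF (i : Fin n) : Continuous fun x => fderiv ℝ F x (EuclideanSpace.single i 1) :=
    (hF.continuous_fderiv one_ne_zero).clm_apply continuous_const
  have hdV (i : Fin n) :
      Continuous fun x => fderiv ℝ (fun y => V y i) x (EuclideanSpace.single i 1) :=
    ((hVi i).continuous_fderiv one_ne_zero).clm_apply continuous_const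
  have int1 (i : Fin n) :
      Integrable fun x => fderiv ℝ F x (EuclideanSpace.single i 1) * V x i :=
    ((hdF i).mul (hVi i).continuous).integrable_of_hasCompactSupport
      (hFc.fderiv_apply ℝ _).mul_right
  have int2 (i : Fin n) :
      Integrable fun x => F x * fderiv ℝ (fun y => V y i) x (EuclideanSpace.single i 1) :=
    (hF.continuous.mul (hdV i)).integrable_of_hasCompactSupport hFc.mul_right
  have int3 (i : Fin n) : Integrable fun x => F x * V x i :=
    (hF.continuous.mul (hVi i).continuous).integrable_of_hasCompactSupport hFc.mul_right
  simp_rw [fderiv_apply_eq_sum F _ (V _), Matrix.trace, Matrix.diag, jacMatrix, Finset.mul_sum]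
  rw [integral_finsetSum _ fun i _ => int2 i, integral_finsetSum _ fun i _ => int1 i,
    ← Finset.sum_neg_distrib]
  refine Finset.sum_congr rfl fun i _ => ?_
  exact integral_mul_fderiv_eq_neg_fderiv_mul_of_integrable (int1 i) (int2 i) (int3 i)
    (fun x _ => hF.differentiable one_ne_zero x) fun x _ => (hVi i).differentiable one_ne_zero x

/-- If `V` is bounded, `V · Du ≥ 0`, and `div V` is bounded below by a positive constant on
`{u > a}`, then `u 0 ≤ a`. -/
theorem le_of_le_trace_jacMatrix {n : ℕ} {u : Euc n → ℝ} {V : Euc n → Euc n} {L κ a : ℝ}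
    (hu : ContDiff ℝ 1 u) (hV : ContDiff ℝ 1 V) (hL : ∀ x, ‖V x‖ ≤ L)
    (huV : ∀ x, 0 ≤ fderiv ℝ u x (V x)) (hκ : 0 < κ)
    (hdiv : ∀ x, a < u x → κ ≤ (jacMatrix V x).trace) : u 0 ≤ a := by
  by_contra! ha
  set m := 2 * n
  set w : Euc n → ℝ := fun x => Real.smoothTransition (u x - a) with hw
  have hwC : ContDiff ℝ 1 w := Real.smoothTransition.contDiff.comp (hu.sub contDiff_const)
  have hw0 (x) : 0 ≤ w x := Real.smoothTransition.nonneg _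
  have hw1 (x) : w x ≤ 1 := Real.smoothTransition.le_one _
  have hwV (x) : 0 ≤ fderiv ℝ w x (V x) := by
    have hs : DifferentiableAt ℝ Real.smoothTransition (u x - a) :=
      (Real.smoothTransition.contDiff (n := 1)).differentiable (by simp) _
    have h : HasFDerivAt w (deriv Real.smoothTransition (u x - a) • fderiv ℝ u x) x :=
      HasDerivAt.comp_hasFDerivAt (f := fun y => u y - a) x hs.hasDerivAt
        ((hu.differentiable one_ne_zero x).hasFDerivAt.sub_const a)
    rw [h.fderiv]
    exact mul_nonneg Real.smoothTransition.monotone.deriv_nonneg (huV x)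
  have hL0 : 0 ≤ L := (norm_nonneg _).trans (hL 0)
  set I : ℝ → ℝ := fun S => ∫ x, w x * cutoff n m S x with hI
  have hFC (S : ℝ) : ContDiff ℝ 1 fun x => w x * cutoff n m S x := hwC.mul (contDiff_cutoff n m S)
  have hFc {S : ℝ} (hS : 0 < S) : HasCompactSupport fun x => w x * cutoff n m S x :=
    (hasCompactSupport_cutoff n m hS).mul_left
  have hFint {S : ℝ} (hS : 0 < S) : Integrable fun x => w x * cutoff n m S x :=
    (hFC S).continuous.integrable_of_hasCompactSupport (hFc hS)
  set ω := volume.real (Metric.closedBall (0 : Euc n) 1) with hω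
  have key {S : ℝ} (hS : 0 < S) :
      κ * I S ≤ 2 * (m + 2) * L / S * I S + 2 * (m + 2) * L * ω / S ^ 3 := by
    have hball : IntegrableOn (fun _ => 2 * (m + 2) * L / S ^ (m + 3))
        (Metric.closedBall (0 : Euc n) (S ^ 2)) :=
      continuous_const.continuousOn.integrableOn_compact (isCompact_closedBall _ _)
    calc κ * I S = ∫ x, κ * (w x * cutoff n m S x) := (integral_const_mul _ _).symm
      _ ≤ ∫ x, w x * cutoff n m S x * (jacMatrix V x).trace := by
          refine integral_mono ((hFint hS).const_mul κ) ?_ fun x => ?_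
          · refine Continuous.integrable_of_hasCompactSupport ?_ (hFc hS).mul_right
            refine (hFC S).continuous.mul (continuous_finsetSum _ fun i _ => ?_)
            have hVi : ContDiff ℝ 1 fun y => V y i := by fun_prop
            exact (hVi.continuous_fderiv one_ne_zero).clm_apply continuous_const
          · rcases le_or_gt (u x) a with h | h
            · simp [hw, Real.smoothTransition.zero_of_nonpos (sub_nonpos.2 h)]
            · have := mul_nonneg (hw0 x) (cutoff_nonneg n m S x)
              have := mul_le_mul_of_nonneg_right (hdiv x h) this
              simpa only [mul_comm] using this
      _ = ∫ x, -fderiv ℝ (fun x => w x * cutoff n m S x) x (V x) := by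
          rw [integral_mul_trace_jacMatrix (hFC S) (hFc hS) hV, integral_neg]
      _ ≤ ∫ x, (2 * (m + 2) * L / S * (w x * cutoff n m S x) +
            (Metric.closedBall (0 : Euc n) (S ^ 2)).indicator
              (fun _ => 2 * (m + 2) * L / S ^ (m + 3)) x) := by
          refine integral_mono ?_ (((hFint hS).const_mul _).add
            (hball.integrable_indicator Metric.isClosed_closedBall.measurableSet)) fun x => ?_
          · refine (Continuous.integrable_of_hasCompactSupport
              (((hFC S).continuous_fderiv one_ne_zero).clm_apply hV.continuous) ?_).neg
            exact ((hFc hS).fderiv ℝ).mono fun x hx h => hx (by simp [h])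
          · have hd : fderiv ℝ (fun x => w x * cutoff n m S x) x (V x) =
                w x * fderiv ℝ (cutoff n m S) x (V x) +
                  cutoff n m S x * fderiv ℝ w x (V x) := by
              rw [fderiv_fun_mul (hwC.differentiable one_ne_zero x)
                ((contDiff_cutoff n m S).differentiable one_ne_zero x)]
              simp
            have h1 := mul_nonneg (cutoff_nonneg n m S x) (hwV x)
            have h2 := mul_le_mul_of_nonneg_left
              (neg_fderiv_cutoff_le n m (x := x) hS (hL x)) (hw0 x)
            have h3 : 0 ≤ (Metric.closedBall (0 : Euc n) (S ^ 2)).indicator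
                (fun _ => 2 * (m + 2) * L / S ^ (m + 3)) x :=
              indicator_nonneg (fun _ _ => by positivity) x
            have h4 := mul_le_of_le_one_left h3 (hw1 x)
            simp only [hd]
            linarith
      _ = _ := by
          rw [integral_add ((hFint hS).const_mul _)
            (hball.integrable_indicator Metric.isClosed_closedBall.measurableSet),
            integral_const_mul, integral_indicator Metric.isClosed_closedBall.measurableSet,
            setIntegral_const, Measure.addHaar_real_closedBall' _ _ (by positivity)]
          simp only [hI, finrank_euclideanSpace, Fintype.card_fin, smul_eq_mul, ← hω, ← pow_mul]
          rw [show S ^ (m + 3) = S ^ (2 * n) * S ^ 3 from pow_add _ _ _]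
          field_simp
  have hI1 : 0 < I 1 := by
    refine (hFC 1).continuous.integral_pos_of_hasCompactSupport_nonneg_nonzero (hFc one_pos)
      (fun x => mul_nonneg (hw0 x) (cutoff_nonneg n m 1 x)) (x := 0) (ne_of_gt ?_)
    refine mul_pos (Real.smoothTransition.pos_of_pos (sub_pos.2 ha)) ?_
    simp [cutoff]
  have hIS {S : ℝ} (hS : 1 ≤ S) : I 1 ≤ I S :=
    integral_mono (hFint one_pos) (hFint (by linarith)) fun x =>
      mul_le_mul_of_nonneg_left (cutoff_mono n m hS x) (hw0 x)
  have lim1 : Tendsto (fun S : ℝ => 2 * (m + 2) * L / S) atTop (𝓝 0) :=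
    tendsto_const_nhds.div_atTop tendsto_id
  have lim2 : Tendsto (fun S : ℝ => 2 * (m + 2) * L * ω / S ^ 3) atTop (𝓝 0) :=
    tendsto_const_nhds.div_atTop (tendsto_pow_atTop (by norm_num))
  have hle : (κ - 0) * I 1 ≤ 0 := by
    refine le_of_tendsto_of_tendsto ((tendsto_const_nhds.sub lim1).mul_const (I 1)) lim2 ?_
    filter_upwards [eventually_ge_atTop 1, lim1.eventually_lt_const hκ] with S hS hlt
    have h1 := key (one_pos.trans_le hS)
    have h2 := mul_le_mul_of_nonneg_left (hIS hS) (sub_pos.2 hlt).le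
    linarith
  rw [sub_zero] at hle
  exact absurd hle (not_le.2 (mul_pos hκ hI1))

theorem Cond103.mul_le_of_tendsto {A : ℝ → ℝ} (hA : Cond103 A) {L : ℝ}
    (hL : Tendsto (fun p => p * A p) atTop (𝓝 L)) {p : ℝ} (hp : 0 < p) : p * A p ≤ L := by
  refine ge_of_tendsto hL ?_
  filter_upwards [eventually_ge_atTop p] with q hq
  exact hA.2.2.2.monotoneOn hp (hp.trans_le hq) hq

/-- Corollary 1.6, first part: for f positive nondecreasing on all of ℝ and
lim_{p→∞} pA(p) < ∞, inequality (101) has no entire solution. -/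
theorem no_solution_finite_limit
    (n k : ℕ) (hk : 1 ≤ k) (hkn : k ≤ n) (A f : ℝ → ℝ)
    (hA : Cond103 A)
    (hfin : ∃ L : ℝ, Tendsto (fun p => p * A p) atTop (𝓝 L))
    (hf : Cond117 f) :
    ¬ ∃ u : Euc n → ℝ, IsEntireSol n k A f u := by
  rintro ⟨u, hu, -, V, hV, hVA, hsym, hΓ, hsol⟩
  obtain ⟨L, hL⟩ := hfin
  obtain ⟨-, hfpos, hfmono⟩ := hf
  have hL0 : 0 ≤ L := (mul_pos one_pos (hA.2.1 1 (mem_Ioi.2 one_pos))).le.trans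
    (hA.mul_le_of_tendsto hL one_pos)
  have hC : 0 < (n.choose k : ℝ) ^ ((1 : ℝ) / k) :=
    Real.rpow_pos_of_pos (by exact_mod_cast Nat.choose_pos hkn) _
  set C := (n.choose k : ℝ) ^ ((1 : ℝ) / k)
  have hbound (x) : ‖V x‖ ≤ L := by
    rw [hVA]
    rcases (norm_nonneg (gradient u x)).eq_or_lt with h | h
    · simpa [norm_smul, ← h] using hL0
    · rw [norm_smul, Real.norm_of_nonneg (hA.2.1 _ h).le, mul_comm]
      exact hA.mul_le_of_tendsto hL h
  have hmono (x) : 0 ≤ fderiv ℝ u x (V x) := by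
    rw [← inner_gradient_left, hVA, real_inner_smul_right, real_inner_self_eq_norm_sq]
    rcases (norm_nonneg (gradient u x)).eq_or_lt with h | h
    · simp [← h]
    · exact mul_nonneg (hA.2.1 _ h).le (sq_nonneg _)
  have hdiv (x) : f (u x) / C ≤ (jacMatrix V x).trace := by
    rw [div_le_iff₀' hC, (hsym x).trace_eq_sum_eigenvalues]
    have := (hsol x).trans (sigmaElem_rpow_le hk (hΓ x))
    rwa [sigmaElem_one] at this
  have := le_of_le_trace_jacMatrix (a := u 0 - 1) hu hV hbound hmono
    (div_pos (hfpos (u 0 - 1)) hC)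
    fun x hx => (div_le_div_of_nonneg_right (hfmono hx.le) hC.le).trans (hdiv x)
  linarith
end
end

section
/- Assume A satisfies condition (103) and f satisfies condition (109). Let a > 0, 0 < R ≤ ∞, and let φ be a positive solution of the Cauchy problem (204) on [0,R). Then φ satisfies equation (203) at every r ∈ (0,R); equivalently, (C(n,k)/n)·r^{1−n}·d/dr[ r^{n−k}·(A(φ′(r))φ′(r))^k ] = f(φ(r))^k for all 0 < r < R. -/
open Filter MeasureTheory Set Topology
open scoped ENNReal

noncomputable section

theorem isOpen_IooE (R : ℝ≥0∞) : IsOpen (IooE R) :=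
  isOpen_Ioi.inter (isOpen_lt ENNReal.continuous_ofReal continuous_const)

theorem IooE_subset_IcoE (R : ℝ≥0∞) : IooE R ⊆ IcoE R := fun _ hr => ⟨hr.1.le, hr.2⟩

theorem Icc_subset_IcoE {R : ℝ≥0∞} {r : ℝ} (hr : r ∈ IooE R) : Icc 0 r ⊆ IcoE R :=
  fun _ hs => ⟨hs.1, (ENNReal.ofReal_le_ofReal hs.2).trans_lt hr.2⟩

/-- The integral of a function continuous on `[0,R)` is differentiable in its upper limit. -/
theorem hasDerivAt_integral_of_continuousOn_IcoE {R : ℝ≥0∞} {g : ℝ → ℝ}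
    (hg : ContinuousOn g (IcoE R)) {r : ℝ} (hr : r ∈ IooE R) :
    HasDerivAt (fun ρ => ∫ s in (0:ℝ)..ρ, g s) (g r) r := by
  have hg' := hg.mono (IooE_subset_IcoE R)
  refine intervalIntegral.integral_hasDerivAt_right ?_
    (hg'.stronglyMeasurableAtFilter (isOpen_IooE R) r hr)
    (hg'.continuousAt ((isOpen_IooE R).mem_nhds hr))
  apply ContinuousOn.intervalIntegrable
  rw [uIcc_of_le hr.1.le]
  exact hg.mono (Icc_subset_IcoE hr)

theorem choose_mul_eq_mul_choose_pred_pred {n k : ℕ} (hk : 1 ≤ k) (hkn : k ≤ n) :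
    (n.choose k : ℝ) * k = n * (n - 1).choose (k - 1) := by
  obtain ⟨m, rfl⟩ : ∃ m, n = m + 1 := ⟨n - 1, by omega⟩
  obtain ⟨j, rfl⟩ : ∃ j, k = j + 1 := ⟨k - 1, by omega⟩
  exact_mod_cast (Nat.add_one_mul_choose_eq m j).symm

theorem choose_pred_pred_add_choose_pred {n k : ℕ} (hk : 1 ≤ k) (hkn : k ≤ n) :
    ((n - 1).choose (k - 1) : ℝ) + (n - 1).choose k = n.choose k := by
  obtain ⟨m, rfl⟩ : ∃ m, n = m + 1 := ⟨n - 1, by omega⟩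
  obtain ⟨j, rfl⟩ : ∃ j, k = j + 1 := ⟨k - 1, by omega⟩
  exact_mod_cast (Nat.choose_succ_succ m j).symm

/-- If `G` is locally the positive `k`-th root of `(n / C(n,k)) r^(k-n) I(r)` and
`I' = r^(n-1) F`, then `G` satisfies the radial `k`-Hessian identity with right side `F`. -/
theorem exists_hasDerivAt_radial_identity {n k : ℕ} (hk : 1 ≤ k) (hkn : k ≤ n)
    {G I : ℝ → ℝ} {r F : ℝ} (hr : 0 < r) (hI : 0 < I r)
    (hI' : HasDerivAt I (r ^ (n - 1) * F) r)
    (hG : G =ᶠ[𝓝 r] fun ρ =>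
      (n * ρ ^ ((k:ℝ) - n) / (n.choose k) * I ρ) ^ ((1:ℝ) / k)) :
    ∃ gd : ℝ, HasDerivAt G gd r ∧
      ((n - 1).choose (k - 1) : ℝ) * gd * (G r / r) ^ (k - 1)
        + ((n - 1).choose k : ℝ) * (G r / r) ^ k = F := by
  have hn0 : (0:ℝ) < n := by exact_mod_cast (by omega : 0 < n)
  have hk0 : (0:ℝ) < k := by exact_mod_cast (by omega : 0 < k)
  have hC0 : (0:ℝ) < n.choose k := by exact_mod_cast Nat.choose_pos hkn
  set H : ℝ → ℝ := fun ρ => n * ρ ^ ((k:ℝ) - n) / (n.choose k) * I ρ with hH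
  have hHpos : 0 < H r := by positivity
  have hH' := ((((Real.hasDerivAt_rpow_const (p := (k:ℝ) - n) (Or.inl hr.ne')).const_mul
    (n:ℝ)).div_const (n.choose k : ℝ)).mul hI')
  obtain ⟨gd, hG'⟩ : ∃ gd, HasDerivAt G gd r :=
    ⟨_, (hH'.rpow_const (p := (1:ℝ) / k) (Or.inl hHpos.ne')).congr_of_eventuallyEq hG⟩
  have hpow : G ^ k =ᶠ[𝓝 r] H := by
    filter_upwards [hG, lt_mem_nhds hr, hI'.continuousAt.eventually (lt_mem_nhds hI)]
      with ρ hρG hρ hIρ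
    have hHρ : 0 ≤ H ρ := by simp only [hH]; positivity
    rw [Pi.pow_apply, hρG, one_div, Real.rpow_inv_natCast_pow hHρ (by omega)]
  have hGpow : G r ^ k = n * r ^ ((k:ℝ) - n) / (n.choose k) * I r := hpow.eq_of_nhds
  have hder := (hG'.pow k).unique (hH'.congr_of_eventuallyEq hpow)
  have hrpow : r ^ ((k:ℝ) - n) * r ^ (n - 1) = r ^ (k - 1) := by
    rw [← Real.rpow_natCast, ← Real.rpow_natCast, ← Real.rpow_add hr, Nat.cast_sub hk,
      Nat.cast_sub (hk.trans hkn)]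
    congr 1
    ring
  rw [Real.rpow_sub_one hr.ne'] at hder
  have hkey : k * G r ^ (k - 1) * gd
      = (k - n) / r * G r ^ k + n / n.choose k * r ^ (k - 1) * F := by
    rw [hder, hGpow, ← hrpow]
    ring
  have hc := choose_mul_eq_mul_choose_pred_pred hk hkn
  have hp := choose_pred_pred_add_choose_pred hk hkn
  refine ⟨gd, hG', ?_⟩
  have hc₁ : ((n - 1).choose (k - 1) : ℝ) = n.choose k * k / n := by
    rw [eq_div_iff hn0.ne', hc, mul_comm]
  have hc₂ : ((n - 1).choose k : ℝ) = n.choose k - n.choose k * k / n := by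
    rw [← hc₁, ← hp]
    ring
  rw [hc₁, hc₂]
  obtain ⟨j, rfl⟩ : ∃ j, k = j + 1 := ⟨k - 1, by omega⟩
  simp only [Nat.add_sub_cancel] at hkey ⊢
  have hmul : (n.choose (j + 1) : ℝ) / n / r ^ j * (((j + 1 : ℕ) : ℝ) * G r ^ j * gd) = _ :=
    congrArg _ hkey
  have hF : (n.choose (j + 1) : ℝ) / n / r ^ j * (n / n.choose (j + 1) * r ^ j * F) = F := by
    field_simp
  rw [mul_add, hF] at hmul
  rw [← sub_eq_iff_eq_add'] at hmul
  rw [← hmul, div_pow, div_pow]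
  field_simp
  ring

/-- Lemma 2.1 (ODE part): a positive solution of the Cauchy problem (204) satisfies
equation (203) at every r ∈ (0,R). -/
theorem cauchySol_ode
    (n k : ℕ) (hk : 1 ≤ k) (hkn : k ≤ n) (A f : ℝ → ℝ)
    (hA : Cond103 A) (hf : Cond109 f)
    (a : ℝ) (ha : 0 < a) (R : ℝ≥0∞) (hR : 0 < R)
    (φ : ℝ → ℝ) (hφ : IsCauchySol n k A f a R φ) :
    ∀ r ∈ IooE R, ∃ gd : ℝ,
      HasDerivAt (fun ρ => A (deriv φ ρ) * deriv φ ρ) gd r ∧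
      ((n-1).choose (k-1) : ℝ) * gd * (A (deriv φ r) * deriv φ r / r) ^ (k-1)
        + ((n-1).choose k : ℝ) * (A (deriv φ r) * deriv φ r / r) ^ k
        = f (φ r) ^ k := by
  intro r hr
  obtain ⟨hφc, -, -, -, hφpos, heq⟩ := hφ
  obtain ⟨hfc, hfpos, -⟩ := hf
  have hgc : ContinuousOn (fun s => s ^ (n - 1) * f (φ s) ^ k) (IcoE R) :=
    (continuous_pow _).continuousOn.mul ((hfc.comp hφc hφpos).pow k)
  have hIpos : ∀ ρ ∈ IooE R, 0 < ∫ s in (0:ℝ)..ρ, s ^ (n - 1) * f (φ s) ^ k := by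
    intro ρ hρ
    refine intervalIntegral.integral_pos hρ.1 (hgc.mono (Icc_subset_IcoE hρ)) ?_
      ⟨ρ, right_mem_Icc.2 hρ.1.le, ?_⟩
    · intro s hs
      have := hfpos _ (hφpos s (Icc_subset_IcoE hρ (Ioc_subset_Icc_self hs)))
      have := hs.1
      positivity
    · have := hfpos _ (hφpos ρ (IooE_subset_IcoE R hρ))
      have := hρ.1
      positivity
  have hderiv_pos : ∀ ρ ∈ IooE R, 0 < deriv φ ρ := by
    intro ρ hρ
    have hn : (0:ℝ) < n := by exact_mod_cast (by omega : 0 < n)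
    have hC : (0:ℝ) < n.choose k := by exact_mod_cast Nat.choose_pos hkn
    have hprod : 0 < A |deriv φ ρ| * deriv φ ρ := by
      have := hIpos ρ hρ
      have := hρ.1
      rw [heq ρ hρ]
      positivity
    have hne : deriv φ ρ ≠ 0 := fun h => by simp [h] at hprod
    exact (pos_iff_pos_of_mul_pos hprod).1 (hA.2.1 _ (abs_pos.2 hne))
  refine exists_hasDerivAt_radial_identity hk hkn hr.1 (hIpos r hr)
    (hasDerivAt_integral_of_continuousOn_IcoE hgc hr) ?_
  filter_upwards [(isOpen_IooE R).mem_nhds hr] with ρ hρ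
  rw [← heq ρ hρ, abs_of_pos (hderiv_pos ρ hρ)]
end
end

section
/- Assume A satisfies condition (103) and f satisfies condition (109). Then for every a > 0 there exists R > 0 such that the Cauchy problem (204) has a positive solution φ ∈ C[0,R] ∩ C¹(0,R] with φ(0) = a, satisfying the equation of (204) for all 0 < r ≤ R. -/
open Filter MeasureTheory Set Topology
open scoped ENNReal

noncomputable section

/-- The map `p ↦ p * A p` has near `0` a right inverse which extends to a continuous monotone
function on `ℝ` with values in `[0, 1]`. -/
lemma exists_continuous_monotone_rightInverse {A : ℝ → ℝ} (hA : Cond103 A) :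
    ∃ (g : ℝ → ℝ) (b : ℝ), Continuous g ∧ Monotone g ∧ (∀ y, 0 ≤ g y ∧ g y ≤ 1) ∧ 0 < b ∧
      ∀ y ∈ Icc 0 b, A (g y) * g y = y := by
  obtain ⟨-, hpos, hcont, hmono⟩ := hA
  have hb : 0 < A 1 := hpos 1 (by simp)
  have hstrict : StrictMonoOn (fun p => p * A p) (Icc 0 1) := by
    intro x hx y hy hxy
    rcases hx.1.eq_or_lt with rfl | h0
    · simpa using mul_pos hxy (hpos y hxy)
    · exact hmono h0 (h0.trans hxy) hxy
  have himage : (fun p => p * A p) '' Icc 0 1 = Icc 0 (A 1) := by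
    have := (hcont.mono Icc_subset_Ici_self).image_Icc_of_monotoneOn zero_le_one
      hstrict.monotoneOn
    simpa using this
  let e : Icc (0 : ℝ) 1 ≃o Icc 0 (A 1) :=
    (hstrict.orderIso _ _).trans (OrderIso.setCongr _ _ himage)
  refine ⟨fun y => e.symm (projIcc 0 (A 1) hb.le y), A 1, ?_, ?_, ?_, hb, ?_⟩
  · exact continuous_subtype_val.comp (e.symm.continuous.comp continuous_projIcc)
  · exact fun x y hxy => e.symm.monotone (monotone_projIcc hb.le hxy)
  · exact fun y => (e.symm (projIcc 0 (A 1) hb.le y)).2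
  · intro y hy
    have h : ((e (e.symm ⟨y, hy⟩) : Icc 0 (A 1)) : ℝ) = y := by rw [e.apply_symm_apply]
    simp only [projIcc_of_mem hb.le hy]
    rw [mul_comm]
    exact h

/-- The right-hand side of the Cauchy problem. -/
def cauchyRhs (n k : ℕ) (f φ : ℝ → ℝ) (r : ℝ) : ℝ :=
  (n * r ^ ((k:ℝ) - n) / (n.choose k) * ∫ s in (0:ℝ)..r, s ^ (n-1) * f (φ s) ^ k) ^ ((1:ℝ)/k)

section CauchyRhs

variable {n k : ℕ} {f φ ψ : ℝ → ℝ} {a : ℝ}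

lemma intervalIntegrable_pow_mul_comp (n k : ℕ) (hf : Cond109 f) (hφ : Monotone φ)
    (hpos : ∀ s, 0 < φ s) (x y : ℝ) :
    IntervalIntegrable (fun s => s ^ (n-1) * f (φ s) ^ k) volume x y := by
  have hmono : Monotone fun s => f (φ s) ^ k := fun s t hst =>
    pow_le_pow_left₀ (hf.2.1 _ (hpos s)).le (hf.2.2 (hpos s) (hpos t) (hφ hst)) k
  exact hmono.intervalIntegrable.continuousOn_mul (by fun_prop)

lemma continuous_primitive_pow_mul_comp (n k : ℕ) (hf : Cond109 f) (hφ : Monotone φ)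
    (hpos : ∀ s, 0 < φ s) :
    Continuous fun r => ∫ s in (0:ℝ)..r, s ^ (n-1) * f (φ s) ^ k :=
  intervalIntegral.continuous_primitive
    (fun x y => intervalIntegrable_pow_mul_comp n k hf hφ hpos x y) 0

lemma measurable_cauchyRhs (hf : Cond109 f) (hφ : Monotone φ) (hpos : ∀ s, 0 < φ s) :
    Measurable (cauchyRhs n k f φ) := by
  have := (continuous_primitive_pow_mul_comp n k hf hφ hpos).measurable
  unfold cauchyRhs
  fun_prop

lemma continuousOn_cauchyRhs (hf : Cond109 f) (hφ : Monotone φ) (hpos : ∀ s, 0 < φ s) :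
    ContinuousOn (cauchyRhs n k f φ) (Ioi 0) := by
  have hintegral := (continuous_primitive_pow_mul_comp n k hf hφ hpos).continuousOn (s := Ioi 0)
  have hpow : ContinuousOn (fun r : ℝ => r ^ ((k:ℝ) - n)) (Ioi 0) :=
    continuousOn_id.rpow_const fun r hr => Or.inl (ne_of_gt hr)
  exact (((continuousOn_const.mul hpow).div_const _).mul hintegral).rpow_const
    fun _ _ => Or.inr (by positivity)

lemma integral_pow_mul_comp_nonneg (n k : ℕ) (hf : Cond109 f) (hpos : ∀ s, 0 < φ s)
    {r : ℝ} (hr : 0 ≤ r) : 0 ≤ ∫ s in (0:ℝ)..r, s ^ (n-1) * f (φ s) ^ k :=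
  intervalIntegral.integral_nonneg hr fun s hs =>
    mul_nonneg (pow_nonneg hs.1 _) (pow_nonneg (hf.2.1 _ (hpos s)).le _)

lemma cauchyRhs_nonneg (hf : Cond109 f) (hpos : ∀ s, 0 < φ s) {r : ℝ} (hr : 0 ≤ r) :
    0 ≤ cauchyRhs n k f φ r := by
  have := integral_pow_mul_comp_nonneg n k hf hpos hr
  unfold cauchyRhs
  positivity

lemma cauchyRhs_mono (hf : Cond109 f) (hφ : Monotone φ) (hψ : Monotone ψ)
    (hpos : ∀ s, 0 < φ s) (hle : ∀ s, φ s ≤ ψ s) {r : ℝ} (hr : 0 ≤ r) :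
    cauchyRhs n k f φ r ≤ cauchyRhs n k f ψ r := by
  have hpos' : ∀ s, 0 < ψ s := fun s => (hpos s).trans_le (hle s)
  have hnonneg := integral_pow_mul_comp_nonneg n k hf hpos hr
  have hintegral : ∫ s in (0:ℝ)..r, s ^ (n-1) * f (φ s) ^ k ≤
      ∫ s in (0:ℝ)..r, s ^ (n-1) * f (ψ s) ^ k := by
    refine intervalIntegral.integral_mono_on hr
      (intervalIntegrable_pow_mul_comp n k hf hφ hpos _ _)
      (intervalIntegrable_pow_mul_comp n k hf hψ hpos' _ _) fun s hs => ?_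
    exact mul_le_mul_of_nonneg_left (pow_le_pow_left₀ (hf.2.1 _ (hpos s)).le
      (hf.2.2 (hpos s) (hpos' s) (hle s)) k) (pow_nonneg hs.1 _)
  unfold cauchyRhs
  gcongr

lemma cauchyRhs_le (hk : 1 ≤ k) (hkn : k ≤ n) (hf : Cond109 f) (hφ : Monotone φ)
    (hpos : ∀ s, 0 < φ s) {b : ℝ} (hle : ∀ s, φ s ≤ b) {r : ℝ} (hr : 0 < r) :
    cauchyRhs n k f φ r ≤ r * f b := by
  have hb : 0 < b := (hpos 0).trans_le (hle 0)
  have hfb : 0 < f b := hf.2.1 b hb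
  have hn : (0:ℝ) < n := by exact_mod_cast hk.trans hkn
  have hchoose : (1:ℝ) ≤ n.choose k := by exact_mod_cast Nat.choose_pos hkn
  refine (cauchyRhs_mono hf hφ monotone_const hpos hle hr.le).trans ?_
  have hintegral : ∫ s in (0:ℝ)..r, s ^ (n-1) * f b ^ k = r ^ n / n * f b ^ k := by
    have h1 : n - 1 + 1 = n := by omega
    rw [intervalIntegral.integral_mul_const, integral_pow, h1]
    have h2 : ((n - 1 : ℕ) : ℝ) + 1 = n := by exact_mod_cast h1
    rw [h2, zero_pow (by omega), sub_zero]
  have hval : n * r ^ ((k:ℝ) - n) / (n.choose k) * (r ^ n / n * f b ^ k) =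
      (r * f b) ^ k / n.choose k := by
    rw [Real.rpow_sub hr, Real.rpow_natCast, Real.rpow_natCast]
    field_simp
    rw [mul_pow]
  rw [cauchyRhs, hintegral, hval]
  calc ((r * f b) ^ k / n.choose k) ^ ((1:ℝ)/k)
      ≤ ((r * f b) ^ k) ^ ((1:ℝ)/k) := by
        gcongr
        exact div_le_self (by positivity) hchoose
    _ = r * f b := by
        rw [one_div, Real.pow_rpow_inv_natCast (by positivity) (by omega)]

lemma intervalIntegrable_comp_cauchyRhs {g : ℝ → ℝ} (hg : Continuous g)
    (hg01 : ∀ y, 0 ≤ g y ∧ g y ≤ 1) (hf : Cond109 f) (hφ : Monotone φ) (hpos : ∀ s, 0 < φ s)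
    (x y : ℝ) : IntervalIntegrable (fun s => g (cauchyRhs n k f φ s)) volume x y := by
  refine (intervalIntegrable_const (c := (1:ℝ))).mono_fun
    (hg.measurable.comp (measurable_cauchyRhs hf hφ hpos)).aestronglyMeasurable
    (ae_of_all _ fun s => ?_)
  simpa [abs_of_nonneg (hg01 _).1] using (hg01 _).2

/-- The integral equation associated with the Cauchy problem has a monotone solution on `[0, 1]`,
by the Knaster–Tarski theorem. -/
lemma exists_monotone_fixedPoint {g : ℝ → ℝ} (n k : ℕ) (hg : Continuous g) (hgm : Monotone g)
    (hg01 : ∀ y, 0 ≤ g y ∧ g y ≤ 1) (hf : Cond109 f) (ha : 0 < a) :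
    ∃ φ : ℝ → ℝ, Monotone φ ∧ (∀ r, a ≤ φ r ∧ φ r ≤ a + 1) ∧
      ∀ r ∈ Icc (0:ℝ) 1, φ r = a + ∫ s in (0:ℝ)..r, g (cauchyRhs n k f φ s) := by
  have : Fact (a ≤ a + 1) := ⟨by linarith⟩
  have hmon (φ : ℝ →o Icc a (a + 1)) : Monotone fun s => (φ s : ℝ) := fun _ _ h => φ.monotone h
  have hpos (φ : ℝ →o Icc a (a + 1)) (s : ℝ) : 0 < (φ s : ℝ) := ha.trans_le (φ s).2.1
  have hintble (φ : ℝ →o Icc a (a + 1)) (x y : ℝ) :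
      IntervalIntegrable (fun s => g (cauchyRhs n k f (fun t => φ t) s)) volume x y :=
    intervalIntegrable_comp_cauchyRhs hg hg01 hf (hmon φ) (hpos φ) x y
  let clamp (r : ℝ) : ℝ := projIcc 0 1 zero_le_one r
  have hclamp (r : ℝ) : clamp r ∈ Icc 0 1 := (projIcc 0 1 zero_le_one r).2
  let I (φ : ℝ →o Icc a (a + 1)) (r : ℝ) : ℝ :=
    ∫ s in (0:ℝ)..clamp r, g (cauchyRhs n k f (fun t => φ t) s)
  have hI (φ : ℝ →o Icc a (a + 1)) (r : ℝ) : 0 ≤ I φ r ∧ I φ r ≤ 1 := by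
    refine ⟨intervalIntegral.integral_nonneg (hclamp r).1 fun s _ => (hg01 _).1, ?_⟩
    calc I φ r ≤ ∫ _ in (0:ℝ)..clamp r, (1:ℝ) :=
          intervalIntegral.integral_mono_on (hclamp r).1 (hintble φ _ _)
            intervalIntegrable_const fun s _ => (hg01 _).2
      _ ≤ 1 := by simpa using (hclamp r).2
  let T : (ℝ →o Icc a (a + 1)) →o (ℝ →o Icc a (a + 1)) :=
    { toFun := fun φ =>
        { toFun := fun r => ⟨a + I φ r, by linarith [(hI φ r).1], by linarith [(hI φ r).2]⟩
          monotone' := fun x y hxy => Subtype.mk_le_mk.2 <| by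
            have hxy' : clamp x ≤ clamp y := monotone_projIcc zero_le_one hxy
            exact add_le_add_right (intervalIntegral.integral_mono_interval le_rfl (hclamp x).1
              hxy' (ae_of_all _ fun s => (hg01 _).1) (hintble φ _ _)) a }
      monotone' := fun φ ψ hφψ r => Subtype.mk_le_mk.2 <| add_le_add_right
        (intervalIntegral.integral_mono_on (hclamp r).1 (hintble φ _ _) (hintble ψ _ _)
          fun s hs => hgm (cauchyRhs_mono hf (hmon φ) (hmon ψ) (hpos φ)
            (fun t => hφψ t) hs.1)) a }
  obtain ⟨φ, hfix⟩ : ∃ φ, T φ = φ :=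
    ⟨OrderHom.lfp (α := ℝ →o Icc a (a + 1)) T, OrderHom.map_lfp (α := ℝ →o Icc a (a + 1)) T⟩
  refine ⟨fun r => φ r, hmon φ, fun r => (φ r).2, fun r hr => ?_⟩
  have hr' : clamp r = r := congrArg Subtype.val (projIcc_of_mem zero_le_one hr)
  calc (φ r : ℝ) = T φ r := by rw [hfix]
    _ = a + ∫ s in (0:ℝ)..clamp r, g (cauchyRhs n k f (fun t => φ t) s) := rfl
    _ = _ := by rw [hr']

end CauchyRhs

/-- Lemma 2.4 (local existence): for every a > 0 there is R > 0 such that the Cauchy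
problem (204) has a positive solution on [0,R]. -/
theorem cauchy_local_existence
    (n k : ℕ) (hk : 1 ≤ k) (hkn : k ≤ n) (A f : ℝ → ℝ)
    (hA : Cond103 A) (hf : Cond109 f) :
    ∀ a : ℝ, 0 < a → ∃ R : ℝ, 0 < R ∧ ∃ φ φd : ℝ → ℝ,
      φ 0 = a ∧
      (∀ r ∈ Icc (0:ℝ) R, 0 < φ r) ∧
      ContinuousOn φ (Icc 0 R) ∧
      ContinuousOn φd (Ioc 0 R) ∧
      (∀ r ∈ Ioc (0:ℝ) R, HasDerivWithinAt φ (φd r) (Icc 0 R) r) ∧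
      ∀ r ∈ Ioc (0:ℝ) R,
        A |φd r| * φd r =
          (n * r ^ ((k:ℝ) - n) / (n.choose k) * ∫ s in (0:ℝ)..r, s ^ (n-1) * f (φ s) ^ k)
            ^ ((1:ℝ)/k) := by
  intro a ha
  obtain ⟨g, b, hg, hgm, hg01, hb, hinv⟩ := exists_continuous_monotone_rightInverse hA
  obtain ⟨φ, hφ, hbound, hfix⟩ := exists_monotone_fixedPoint n k hg hgm hg01 hf ha
  have hpos (s : ℝ) : 0 < φ s := ha.trans_le (hbound s).1
  have hM : 0 < f (a + 1) := hf.2.1 _ (by simp; linarith)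
  have hintble := intervalIntegrable_comp_cauchyRhs (n := n) (k := k) hg hg01 hf hφ hpos
  have hcont : ContinuousOn (fun r => g (cauchyRhs n k f φ r)) (Ioi 0) :=
    hg.comp_continuousOn (continuousOn_cauchyRhs hf hφ hpos)
  have hsub : Icc 0 (min 1 (b / f (a + 1))) ⊆ Icc 0 1 := Icc_subset_Icc_right (min_le_left _ _)
  refine ⟨min 1 (b / f (a + 1)), by positivity, φ, fun r => g (cauchyRhs n k f φ r),
    ?_, fun r _ => hpos r, ?_, hcont.mono fun r hr => hr.1, ?_, ?_⟩
  · simpa using hfix 0 (by simp)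
  · exact (continuous_const.add
      (intervalIntegral.continuous_primitive hintble 0)).continuousOn.congr
      fun r hr => hfix r (hsub hr)
  · intro r hr
    have hderiv : HasDerivAt (fun x => ∫ s in (0:ℝ)..x, g (cauchyRhs n k f φ s))
        (g (cauchyRhs n k f φ r)) r :=
      intervalIntegral.integral_hasDerivAt_right (hintble 0 r)
        (hg.measurable.comp
          (measurable_cauchyRhs hf hφ hpos)).stronglyMeasurable.stronglyMeasurableAtFilter
        (hcont.continuousAt (Ioi_mem_nhds hr.1))
    exact (hderiv.const_add a).hasDerivWithinAt.congr (fun x hx => hfix x (hsub hx))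
      (hfix r (hsub (Ioc_subset_Icc_self hr)))
  · intro r hr
    have hle : r * f (a + 1) ≤ b := (le_div_iff₀ hM).1 (hr.2.trans (min_le_right _ _))
    rw [abs_of_nonneg (hg01 _).1]
    exact hinv _ ⟨cauchyRhs_nonneg hf hpos hr.1.le,
      (cauchyRhs_le hk hkn hf hφ hpos (fun s => (hbound s).2) hr.1).trans hle⟩
end
end

section
/- Assume A satisfies condition (103) and condition (108) for some m > 1, and let k ≥ 1 be an integer. Then 0 < liminf_{p→∞} Ψ(p)/p^{k(m−1)+1} ≤ limsup_{p→∞} Ψ(p)/p^{k(m−1)+1} < ∞, and consequently 0 < liminf_{p→∞} Ψ⁻¹(p)/p^{1/(k(m−1)+1)} ≤ limsup_{p→∞} Ψ⁻¹(p)/p^{1/(k(m−1)+1)} < ∞. -/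
open Filter MeasureTheory Set Topology
open scoped ENNReal

noncomputable section

/-- `p G(p) − ∫₀^p G`, the general form of `Psi`. -/
def legendreGap (G : ℝ → ℝ) (p : ℝ) : ℝ := p * G p - ∫ t in (0:ℝ)..p, G t

section LegendreGap

variable {G : ℝ → ℝ}

lemma legendreGap_le (h0 : ∀ t, 0 ≤ t → 0 ≤ G t) {p : ℝ} (hp : 0 ≤ p) :
    legendreGap G p ≤ p * G p := by
  have : 0 ≤ ∫ t in (0:ℝ)..p, G t :=
    intervalIntegral.integral_nonneg hp fun t ht => h0 t ht.1
  unfold legendreGap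
  linarith

lemma MonotoneOn.intervalIntegrable_of_nonneg (hG : MonotoneOn G (Ici 0)) {a b : ℝ}
    (ha : 0 ≤ a) (hb : 0 ≤ b) : IntervalIntegrable G volume a b :=
  (hG.mono fun _ ht => (le_min ha hb).trans ht.1).intervalIntegrable

lemma intervalIntegral_le_mul_of_monotoneOn (hG : MonotoneOn G (Ici 0)) {a b : ℝ}
    (ha : 0 ≤ a) (hab : a ≤ b) : ∫ t in a..b, G t ≤ (b - a) * G b := by
  have h := intervalIntegral.integral_mono_on hab
    (hG.intervalIntegrable_of_nonneg ha (ha.trans hab))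
    (intervalIntegrable_const (c := G b))
    fun t ht => hG (ha.trans ht.1) (ha.trans hab) ht.2
  simpa using h

lemma mul_sub_le_legendreGap (hG : MonotoneOn G (Ici 0)) {q p : ℝ} (hq : 0 ≤ q)
    (hqp : q ≤ p) : q * (G p - G q) ≤ legendreGap G p := by
  have h₁ := intervalIntegral_le_mul_of_monotoneOn hG le_rfl hq
  have h₂ := intervalIntegral_le_mul_of_monotoneOn hG hq hqp
  have h₃ := intervalIntegral.integral_add_adjacent_intervals
    (hG.intervalIntegrable_of_nonneg le_rfl hq)
    (hG.intervalIntegrable_of_nonneg hq (hq.trans hqp))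
  unfold legendreGap
  rw [← h₃]
  linarith

lemma continuousOn_legendreGap (hc : ContinuousOn G (Ici 0)) (b : ℝ) :
    ContinuousOn (legendreGap G) (Icc 0 b) := by
  rcases lt_or_ge b 0 with hb | hb
  · simp [Icc_eq_empty_of_lt hb]
  have hc' : ContinuousOn G (Icc 0 b) := hc.mono fun _ ht => ht.1
  have hint := intervalIntegral.continuousOn_primitive_interval (μ := volume) (f := G) (a := 0)
    (b := b) (by rw [uIcc_of_le hb]; exact hc'.integrableOn_Icc)
  rw [uIcc_of_le hb] at hint
  exact (continuousOn_id.mul hc').sub hint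

/-- A monotone `G ≍ p ^ N` with `N > 0` has `legendreGap G ≍ p ^ (N + 1)`. -/
lemma legendreGap_growth (hG : MonotoneOn G (Ici 0)) (h0 : ∀ t, 0 ≤ t → 0 ≤ G t)
    {N a b : ℝ} (hN : 0 < N) (ha : 0 < a)
    (hab : ∀ᶠ p in atTop, a * p ^ N ≤ G p ∧ G p ≤ b * p ^ N) :
    ∃ c₁ c₂ : ℝ, 0 < c₁ ∧ ∀ᶠ p in atTop,
      c₁ * p ^ (N + 1) ≤ legendreGap G p ∧ legendreGap G p ≤ c₂ * p ^ (N + 1) := by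
  have hb : 0 < b := by
    obtain ⟨p, ⟨h₁, h₂⟩, hp⟩ := (hab.and (eventually_gt_atTop 0)).exists
    have := Real.rpow_pos_of_pos hp N
    nlinarith
  obtain ⟨ε, hε, hε1, hεN⟩ : ∃ ε : ℝ, 0 < ε ∧ ε ≤ 1 ∧ b * ε ^ N ≤ a / 2 := by
    have h : Tendsto (fun x : ℝ => b * x ^ N) (𝓝[>] 0) (𝓝 0) := by
      have h' : ContinuousAt (fun x : ℝ => b * x ^ N) 0 :=
        continuousAt_const.mul (Real.continuousAt_rpow_const 0 N (Or.inr hN.le))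
      simpa [ContinuousAt, Real.zero_rpow hN.ne'] using h'.tendsto.mono_left nhdsWithin_le_nhds
    obtain ⟨ε, h₁, h₂⟩ := ((h.eventually_le_const (half_pos ha)).and
      (Ioc_mem_nhdsGT (zero_lt_one' ℝ))).exists
    exact ⟨ε, h₂.1, h₂.2, h₁⟩
  refine ⟨ε * (a / 2), b, by positivity, ?_⟩
  filter_upwards [hab, (tendsto_id.const_mul_atTop hε).eventually hab, eventually_gt_atTop 0]
    with p hp hεp hp0
  have hpN := Real.rpow_pos_of_pos hp0 N
  rw [Real.rpow_add_one hp0.ne']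
  constructor
  · refine le_trans ?_ (mul_sub_le_legendreGap hG (mul_pos hε hp0).le
      (mul_le_of_le_one_left hp0.le hε1))
    have h := hεp.2
    simp only [id] at h
    rw [Real.mul_rpow hε.le hp0.le, ← mul_assoc] at h
    have h' : a / 2 * p ^ N ≤ G p - G (ε * p) := by nlinarith [hp.1]
    calc _ = ε * p * (a / 2 * p ^ N) := by ring
      _ ≤ _ := by gcongr
  · refine (legendreGap_le h0 hp0.le).trans ?_
    calc p * G p ≤ p * (b * p ^ N) := by gcongr; exact hp.2
      _ = _ := by ring

end LegendreGap

/-- If `F ≍ p ^ M` is continuous on `[0,∞)` with `F 0 ≤ 0`, then the right inverse of `F` on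
`[0,∞)` is `≍ y ^ (1 / M)`. -/
lemma invFunOn_growth {F : ℝ → ℝ} (hF : ∀ b, ContinuousOn F (Icc 0 b)) (hF0 : F 0 ≤ 0)
    {M a b : ℝ} (hM : 0 < M) (ha : 0 < a)
    (hab : ∀ᶠ p in atTop, a * p ^ M ≤ F p ∧ F p ≤ b * p ^ M) :
    ∃ c₁ c₂ : ℝ, 0 < c₁ ∧ ∀ᶠ y in atTop,
      c₁ ≤ Function.invFunOn F (Ici 0) y / y ^ (1 / M) ∧
      Function.invFunOn F (Ici 0) y / y ^ (1 / M) ≤ c₂ := by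
  have hb : 0 < b := by
    obtain ⟨p, ⟨h₁, h₂⟩, hp⟩ := (hab.and (eventually_gt_atTop 0)).exists
    have := Real.rpow_pos_of_pos hp M
    nlinarith
  have htop : Tendsto F atTop atTop :=
    tendsto_atTop_mono' _ (hab.mono fun _ h => h.1)
      ((tendsto_rpow_atTop hM).const_mul_atTop ha)
  obtain ⟨P, hP⟩ := eventually_atTop.1 hab
  obtain ⟨B, hB⟩ := isCompact_Icc.bddAbove_image (hF P)
  refine ⟨(1 / b) ^ (1 / M), (1 / a) ^ (1 / M), by positivity, ?_⟩
  filter_upwards [eventually_gt_atTop 0, eventually_gt_atTop B] with y hy hyB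
  have hex : ∃ q ∈ Ici (0:ℝ), F q = y := by
    obtain ⟨r, hr, hr0⟩ := ((htop.eventually_ge_atTop y).and (eventually_ge_atTop 0)).exists
    obtain ⟨q, hq, hqy⟩ := intermediate_value_Icc hr0 (hF r) ⟨hF0.trans hy.le, hr⟩
    exact ⟨q, hq.1, hqy⟩
  have hq0 : 0 ≤ Function.invFunOn F (Ici 0) y := Function.invFunOn_mem hex
  have hqy := Function.invFunOn_eq hex
  set q := Function.invFunOn F (Ici 0) y
  have hPq : P ≤ q := by
    by_contra! h
    have := hB (mem_image_of_mem F ⟨hq0, h.le⟩)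
    linarith
  obtain ⟨h₁, h₂⟩ := hP q hPq
  rw [hqy] at h₁ h₂
  have hyM : 0 < y ^ (1 / M) := Real.rpow_pos_of_pos hy _
  have hroot : (q ^ M) ^ (1 / M) = q := by
    rw [one_div, Real.rpow_rpow_inv hq0 hM.ne']
  have hqM : 0 ≤ q ^ M := Real.rpow_nonneg hq0 M
  rw [le_div_iff₀ hyM, div_le_iff₀ hyM, ← Real.mul_rpow (by positivity) hy.le,
    ← Real.mul_rpow (by positivity) hy.le]
  constructor
  · conv_rhs => rw [← hroot]
    refine Real.rpow_le_rpow (by positivity) ?_ (by positivity)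
    rwa [one_div_mul_eq_div, div_le_iff₀' hb]
  · conv_lhs => rw [← hroot]
    refine Real.rpow_le_rpow hqM ?_ (by positivity)
    rwa [one_div_mul_eq_div, le_div_iff₀' ha]

lemma Cond103.flux_nonneg {A : ℝ → ℝ} (hA : Cond103 A) {p : ℝ} (hp : 0 ≤ p) : 0 ≤ p * A p := by
  rcases hp.eq_or_lt with rfl | h
  · simp
  · exact (mul_pos h (hA.2.1 p h)).le

lemma Cond103.monotoneOn_flux_pow {A : ℝ → ℝ} (hA : Cond103 A) (k : ℕ) :
    MonotoneOn (fun p => (p * A p) ^ k) (Ici 0) := by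
  intro x hx y hy hxy
  refine pow_le_pow_left₀ (hA.flux_nonneg hx) ?_ k
  rcases (mem_Ici.1 hx).eq_or_lt with rfl | h
  · simpa using hA.flux_nonneg hy
  · exact hA.2.2.2.monotoneOn h (h.trans_le hxy) hxy

lemma Cond103.flux_pow_growth {A : ℝ → ℝ} {m : ℝ} (hA : Cond103 A) (h108 : Cond108 A m)
    (k : ℕ) : ∃ a b : ℝ, 0 < a ∧ ∀ᶠ p in atTop,
      a * p ^ ((k:ℝ) * (m - 1)) ≤ (p * A p) ^ k ∧
      (p * A p) ^ k ≤ b * p ^ ((k:ℝ) * (m - 1)) := by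
  obtain ⟨c₁, c₂, hc₁, h⟩ := h108
  refine ⟨c₁ ^ k, c₂ ^ k, by positivity, ?_⟩
  filter_upwards [h, eventually_gt_atTop 0] with p hp hp0
  have hpm : 0 < p ^ (m - 2) := Real.rpow_pos_of_pos hp0 _
  rw [le_div_iff₀ hpm, div_le_iff₀ hpm] at hp
  have hpow : p ^ ((k:ℝ) * (m - 1)) = (p * p ^ (m - 2)) ^ k := by
    rw [mul_comm (k:ℝ), Real.rpow_mul hp0.le, Real.rpow_natCast,
      show m - 1 = (m - 2) + 1 by ring, Real.rpow_add_one hp0.ne', mul_comm p]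
  rw [hpow, ← mul_pow, ← mul_pow]
  constructor
  · refine pow_le_pow_left₀ (by positivity) ?_ k
    nlinarith [hp.1]
  · refine pow_le_pow_left₀ (hA.flux_nonneg hp0.le) ?_ k
    nlinarith [hp.2]

/-- Lemma 3.5: under (108), Ψ(p) ≍ p^{k(m−1)+1} and Ψ⁻¹(p) ≍ p^{1/(k(m−1)+1)} as p → ∞. -/
theorem Psi_growth
    (k : ℕ) (hk : 1 ≤ k) (A : ℝ → ℝ) (m : ℝ) (hm : 1 < m)
    (hA : Cond103 A) (h108 : Cond108 A m) :
    (∃ c₁ c₂ : ℝ, 0 < c₁ ∧ ∀ᶠ p in atTop,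
        c₁ ≤ Psi A k p / p ^ ((k:ℝ) * (m - 1) + 1) ∧
        Psi A k p / p ^ ((k:ℝ) * (m - 1) + 1) ≤ c₂) ∧
    (∃ c₁ c₂ : ℝ, 0 < c₁ ∧ ∀ᶠ p in atTop,
        c₁ ≤ PsiInv A k p / p ^ (1 / ((k:ℝ) * (m - 1) + 1)) ∧
        PsiInv A k p / p ^ (1 / ((k:ℝ) * (m - 1) + 1)) ≤ c₂) := by
  have hN : 0 < (k:ℝ) * (m - 1) := mul_pos (by exact_mod_cast hk) (by linarith)
  have hPsi : Psi A k = legendreGap fun p => (p * A p) ^ k := rfl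
  obtain ⟨a, b, ha, hab⟩ := hA.flux_pow_growth h108 k
  obtain ⟨c₁, c₂, hc₁, hc⟩ := legendreGap_growth (hA.monotoneOn_flux_pow k)
    (fun t ht => pow_nonneg (hA.flux_nonneg ht) k) hN ha hab
  refine ⟨⟨c₁, c₂, hc₁, ?_⟩, ?_⟩
  · filter_upwards [hc, eventually_gt_atTop 0] with p hp hp0
    have hpM := Real.rpow_pos_of_pos hp0 ((k:ℝ) * (m - 1) + 1)
    rwa [le_div_iff₀ hpM, div_le_iff₀ hpM, hPsi]
  · exact invFunOn_growth (continuousOn_legendreGap (hA.2.2.1.pow k)) (by simp [legendreGap])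
      (by positivity) hc₁ hc
end
end

section
/- Assume A satisfies condition (103) with lim_{p→∞} pA(p) = ∞, and f satisfies condition (109). Let a > 0 and let φ be a positive solution of the Cauchy problem (204) on the whole half-line [0,∞). Then ∫_{φ(1)}^∞ (Ψ⁻¹((k/C(n,k)) ∫_{φ(1)}^s f(t)^k dt))^{−1} ds = ∞. In particular, if ∫_c^∞ (Ψ⁻¹(∫_c^s f(t)^k dt))^{−1} ds < ∞ for some c > 0, then the Cauchy problem (204) has no positive global solution for any a > 0. -/
open Filter MeasureTheory Set Topology
open scoped ENNReal

noncomputable section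

/-- The flux power `(p A(p))^k` is strictly increasing on `[0, ∞)`. -/
theorem Cond103.strictMonoOn_pow {A : ℝ → ℝ} (hA : Cond103 A) {k : ℕ} (hk : 1 ≤ k) :
    StrictMonoOn (fun p => (p * A p) ^ k) (Ici 0) := by
  obtain ⟨-, hpos, -, hmono⟩ := hA
  intro p hp q hq hpq
  rw [mem_Ici] at hp hq
  have hq0 : 0 < q := hp.trans_lt hpq
  rcases hp.eq_or_lt with rfl | hp0
  · have := hpos q hq0
    simp only [zero_mul]
    rw [zero_pow (by omega)]
    positivity
  · have := hpos p hp0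
    exact pow_lt_pow_left₀ (hmono hp0 hq0 hpq) (by positivity) (by omega)

theorem Cond103.continuousOn_pow {A : ℝ → ℝ} (hA : Cond103 A) (k : ℕ) :
    ContinuousOn (fun p => (p * A p) ^ k) (Ici 0) :=
  hA.2.2.1.pow k

theorem Cond103.intervalIntegrable_pow {A : ℝ → ℝ} (hA : Cond103 A) (k : ℕ) {p q : ℝ}
    (hp : 0 ≤ p) (hq : 0 ≤ q) :
    IntervalIntegrable (fun t => (t * A t) ^ k) volume p q :=
  ((hA.continuousOn_pow k).mono fun _ ht => (le_inf hp hq).trans ht.1).intervalIntegrable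

/-- To first order, an increment of `Ψ` is `p` times the increment of `(p A(p))^k`. -/
theorem abs_Psi_sub_sub_le {A : ℝ → ℝ} (hA : Cond103 A) {k : ℕ} (hk : 1 ≤ k) {p q : ℝ}
    (hp : 0 ≤ p) (hq : 0 ≤ q) :
    |Psi A k q - Psi A k p - p * ((q * A q) ^ k - (p * A p) ^ k)| ≤
      |(q * A q) ^ k - (p * A p) ^ k| * |q - p| := by
  have hm := (hA.strictMonoOn_pow hk).monotoneOn
  have hadd := intervalIntegral.integral_add_adjacent_intervals
    (hA.intervalIntegrable_pow k le_rfl hp) (hA.intervalIntegrable_pow k hp hq)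
  have key : Psi A k q - Psi A k p - p * ((q * A q) ^ k - (p * A p) ^ k) =
      ∫ t in p..q, ((q * A q) ^ k - (t * A t) ^ k) := by
    rw [intervalIntegral.integral_sub (by simp) (hA.intervalIntegrable_pow k hp hq),
      intervalIntegral.integral_const, smul_eq_mul, Psi, Psi, ← hadd]
    ring
  rw [key, ← Real.norm_eq_abs]
  refine intervalIntegral.norm_integral_le_of_norm_le_const fun t ht => ?_
  rw [Real.norm_eq_abs]
  rcases le_total p q with h | h
  · rw [uIoc_of_le h] at ht
    have ht0 : t ∈ Ici (0 : ℝ) := hp.trans ht.1.le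
    have h1 := hm hp ht0 ht.1.le
    have h2 := hm ht0 hq ht.2
    simp only at h1 h2
    rw [abs_of_nonneg (by linarith), abs_of_nonneg (by linarith)]
    linarith
  · rw [uIoc_of_ge h] at ht
    have ht0 : t ∈ Ici (0 : ℝ) := hq.trans ht.1.le
    have h1 := hm hq ht0 ht.1.le
    have h2 := hm ht0 hp ht.2
    simp only at h1 h2
    rw [abs_of_nonpos (by linarith), abs_of_nonpos (by linarith)]
    linarith

theorem strictMonoOn_Psi {A : ℝ → ℝ} (hA : Cond103 A) {k : ℕ} (hk : 1 ≤ k) :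
    StrictMonoOn (Psi A k) (Ioi 0) := by
  intro p hp q hq hpq
  rw [mem_Ioi] at hp hq
  have h := abs_Psi_sub_sub_le hA hk hq.le hp.le
  have hB := hA.strictMonoOn_pow hk hp.le hq.le hpq
  simp only at hB
  rw [abs_of_neg (a := (p * A p) ^ k - (q * A q) ^ k) (by linarith),
    abs_of_neg (a := p - q) (by linarith)] at h
  have := (abs_le.1 h).2
  nlinarith [mul_pos hp (sub_pos.2 hB)]

theorem continuousOn_Psi {A : ℝ → ℝ} (hA : Cond103 A) (k : ℕ) {p : ℝ} (hp : 0 ≤ p) :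
    ContinuousOn (Psi A k) (Icc 0 p) := by
  have hB := (hA.continuousOn_pow k).mono (Icc_subset_Ici_self : Icc 0 p ⊆ Ici 0)
  refine (continuousOn_id.mul hB).sub ?_
  have := intervalIntegral.continuousOn_primitive_interval
    ((hB.integrableOn_Icc (μ := volume)).mono_set (uIcc_of_le hp).subset)
  rwa [uIcc_of_le hp] at this

theorem Psi_zero (A : ℝ → ℝ) (k : ℕ) : Psi A k 0 = 0 := by simp [Psi]

theorem PsiInv_mem_Ioc {A : ℝ → ℝ} (hA : Cond103 A) {k : ℕ} (hk : 1 ≤ k) {x p : ℝ}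
    (hp : 0 < p) (hx : 0 < x) (hxp : x ≤ Psi A k p) : PsiInv A k x ∈ Ioc 0 p := by
  obtain ⟨q, hq, hqx⟩ := intermediate_value_Icc hp.le (continuousOn_Psi hA k hp.le)
    ⟨(Psi_zero A k).trans_le hx.le, hxp⟩
  have hex : ∃ q ∈ Ici (0 : ℝ), Psi A k q = x := ⟨q, hq.1, hqx⟩
  have hmem : 0 ≤ PsiInv A k x := Function.invFunOn_mem hex
  have heq : Psi A k (PsiInv A k x) = x := Function.invFunOn_eq hex
  have hpos : 0 < PsiInv A k x := by
    refine hmem.lt_of_ne fun h => ?_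
    rw [← h, Psi_zero] at heq
    exact hx.ne heq
  refine ⟨hpos, le_of_not_gt fun h => ?_⟩
  have := strictMonoOn_Psi hA hk hp hpos h
  linarith

/-- Chain rule for `Ψ ∘ v` when only `(v A(v))^k`, not `v` itself, is differentiable. -/
theorem hasDerivAt_Psi_comp {A : ℝ → ℝ} (hA : Cond103 A) {k : ℕ} (hk : 1 ≤ k)
    {v : ℝ → ℝ} {r d : ℝ} (hv : ContinuousAt v r) (hpos : ∀ᶠ x in 𝓝 r, 0 ≤ v x)
    (hd : HasDerivAt (fun x => (v x * A (v x)) ^ k) d r) :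
    HasDerivAt (fun x => Psi A k (v x)) (v r * d) r := by
  have h1 : (fun x => (v x * A (v x)) ^ k - (v r * A (v r)) ^ k) =O[𝓝 r] fun x => x - r :=
    hd.isBigO_sub
  have h2 : (fun x => v x - v r) =o[𝓝 r] fun _ => (1 : ℝ) := by
    rw [Asymptotics.isLittleO_one_iff]
    simpa using hv.tendsto.sub_const (v r)
  have h3 := h1.mul_isLittleO h2
  have h4 : (fun x => Psi A k (v x) - Psi A k (v r) -
      v r * ((v x * A (v x)) ^ k - (v r * A (v r)) ^ k)) =o[𝓝 r] fun x => (x - r) * 1 := by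
    refine (Asymptotics.IsBigO.of_bound 1 ?_).trans_isLittleO h3
    filter_upwards [hpos] with x hx
    rw [one_mul, norm_mul]
    exact abs_Psi_sub_sub_le hA hk hpos.self_of_nhds hx
  have h5 := (hasDerivAt_iff_isLittleO.1 hd).const_mul_left (v r)
  rw [hasDerivAt_iff_isLittleO]
  refine ((h4.congr_right fun x => mul_one _).add h5).congr_left fun x => ?_
  simp only [smul_eq_mul]
  ring

/-- If `y` stays in `(c, ∞)` for all `r > r₀` and `y' ≥ κ g(y) > 0`, then `∫_c^∞ ds / g(s)`
diverges. -/
theorem lintegral_inv_eq_top_of_le_deriv {y y' g : ℝ → ℝ} {r₀ c κ : ℝ} (hκ : 0 < κ)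
    (hy : ∀ r ∈ Ioi r₀, HasDerivAt y (y' r) r) (hinj : InjOn y (Ioi r₀))
    (hmaps : MapsTo y (Ioi r₀) (Ioi c)) (hg : ∀ r ∈ Ioi r₀, 0 < g (y r))
    (hle : ∀ r ∈ Ioi r₀, κ * g (y r) ≤ y' r) :
    ∫⁻ s in Ioi c, ENNReal.ofReal (g s)⁻¹ = ⊤ := by
  rw [eq_top_iff]
  calc (⊤ : ℝ≥0∞) = ∫⁻ _ in Ioi r₀, ENNReal.ofReal κ := by
        rw [setLIntegral_const, Real.volume_Ioi, ENNReal.mul_top]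
        simpa using hκ
    _ ≤ ∫⁻ r in Ioi r₀, ENNReal.ofReal |y' r| * ENNReal.ofReal (g (y r))⁻¹ := by
        refine setLIntegral_mono' measurableSet_Ioi fun r hr => ?_
        rw [← ENNReal.ofReal_mul (abs_nonneg _)]
        refine ENNReal.ofReal_le_ofReal ?_
        rw [← div_eq_mul_inv, le_div_iff₀ (hg r hr)]
        exact (hle r hr).trans (le_abs_self _)
    _ = ∫⁻ s in y '' Ioi r₀, ENNReal.ofReal (g s)⁻¹ :=
        (lintegral_image_eq_lintegral_abs_deriv_mul measurableSet_Ioi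
          (fun r hr => (hy r hr).hasDerivWithinAt) hinj
          fun s => ENNReal.ofReal (g s)⁻¹).symm
    _ ≤ ∫⁻ s in Ioi c, ENNReal.ofReal (g s)⁻¹ :=
        lintegral_mono_set hmaps.image_subset

/-- For non-decreasing non-negative `w`, the weighted mean `n r^{k-n} ∫₀^r s^{n-1} w` has
derivative at least `k r^{k-1} w(r)`. -/
theorem exists_hasDerivAt_weighted_mean {n k : ℕ} (hk : 1 ≤ k) (hkn : k ≤ n) {w : ℝ → ℝ}
    (hcont : ContinuousOn w (Ici 0)) (hmono : MonotoneOn w (Ici 0)) {r : ℝ} (hr : 0 < r) :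
    ∃ d, HasDerivAt (fun x : ℝ => n * x ^ ((k : ℝ) - n) / (n.choose k) *
        ∫ s in (0 : ℝ)..x, s ^ (n - 1) * w s) d r ∧
      k / (n.choose k : ℝ) * (r ^ (k - 1) * w r) ≤ d := by
  have hn : (0 : ℝ) < n := by exact_mod_cast (by omega : 0 < n)
  have hC : (0 : ℝ) < n.choose k := by exact_mod_cast Nat.choose_pos hkn
  have hint : ContinuousOn (fun s => s ^ (n - 1) * w s) (Ici 0) :=
    (continuousOn_pow _).mul hcont
  have hii : IntervalIntegrable (fun s => s ^ (n - 1) * w s) volume 0 r :=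
    (hint.mono fun t ht => (le_inf le_rfl hr.le).trans ht.1).intervalIntegrable
  have hJ : HasDerivAt (fun x : ℝ => ∫ s in (0 : ℝ)..x, s ^ (n - 1) * w s)
      (r ^ (n - 1) * w r) r :=
    intervalIntegral.integral_hasDerivAt_right hii
      ((hint.mono Ioi_subset_Ici_self).stronglyMeasurableAtFilter isOpen_Ioi r hr)
      (hint.continuousAt (Ici_mem_nhds hr))
  have hP : HasDerivAt (fun x : ℝ => n * x ^ ((k : ℝ) - n) / (n.choose k))
      (n * (((k : ℝ) - n) * r ^ ((k : ℝ) - n - 1)) / (n.choose k)) r :=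
    ((Real.hasDerivAt_rpow_const (Or.inl hr.ne')).const_mul _).div_const _
  refine ⟨_, hP.mul hJ, ?_⟩
  have hJle : ∫ s in (0 : ℝ)..r, s ^ (n - 1) * w s ≤ r ^ n / n * w r := by
    calc ∫ s in (0 : ℝ)..r, s ^ (n - 1) * w s ≤ ∫ s in (0 : ℝ)..r, s ^ (n - 1) * w r := by
          refine intervalIntegral.integral_mono_on hr.le hii
            ((continuous_id.pow _).mul continuous_const).continuousOn.intervalIntegrable
            fun s hs => ?_
          exact mul_le_mul_of_nonneg_left (hmono hs.1 hr.le hs.2) (pow_nonneg hs.1 _)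
      _ = r ^ n / n * w r := by
          rw [intervalIntegral.integral_mul_const, integral_pow]
          have h1 : n - 1 + 1 = n := by omega
          have h2 : ((n - 1 : ℕ) : ℝ) + 1 = n := by exact_mod_cast h1
          rw [h1, h2, zero_pow (by omega), sub_zero]
  have e1 : r ^ ((k : ℝ) - n) * r ^ (n - 1) = r ^ (k - 1) := by
    rw [← Real.rpow_natCast r (n - 1), ← Real.rpow_add hr, ← Real.rpow_natCast r (k - 1)]
    congr 1
    push_cast [Nat.cast_sub hk, Nat.cast_sub (hk.trans hkn)]
    ring
  have e2 : r ^ ((k : ℝ) - n - 1) * r ^ n = r ^ (k - 1) := by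
    rw [← Real.rpow_natCast r n, ← Real.rpow_add hr, ← Real.rpow_natCast r (k - 1)]
    congr 1
    push_cast [Nat.cast_sub hk]
    ring
  have hkn' : (0 : ℝ) ≤ n - k := sub_nonneg.2 (by exact_mod_cast hkn)
  have hR : 0 ≤ r ^ ((k : ℝ) - n - 1) := Real.rpow_nonneg hr.le _
  calc (k : ℝ) / n.choose k * (r ^ (k - 1) * w r)
      = n / n.choose k * (r ^ (k - 1) * w r) -
        n / n.choose k * ((n - k) * r ^ ((k : ℝ) - n - 1)) * (r ^ n / n * w r) := by
        field_simp
        rw [mul_assoc ((n : ℝ) - k), e2]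
        ring
    _ ≤ n / n.choose k * (r ^ (k - 1) * w r) -
        n / n.choose k * ((n - k) * r ^ ((k : ℝ) - n - 1)) *
          ∫ s in (0 : ℝ)..r, s ^ (n - 1) * w s := by
        gcongr
    _ = _ := by
        rw [← e1]
        ring

theorem IcoE_top : IcoE ⊤ = Ici 0 := by ext; simp [IcoE]

theorem IooE_top : IooE ⊤ = Ioi 0 := by ext; simp [IooE]

namespace IsCauchySol

variable {n k : ℕ} {A f φ : ℝ → ℝ} {a : ℝ}

theorem continuousOn_Ici (h : IsCauchySol n k A f a ⊤ φ) : ContinuousOn φ (Ici 0) :=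
  IcoE_top ▸ h.1

theorem hasDerivAt (h : IsCauchySol n k A f a ⊤ φ) {r : ℝ} (hr : 0 < r) :
    HasDerivAt φ (deriv φ r) r :=
  (h.2.1 r (IooE_top ▸ hr)).hasDerivAt

theorem pos (h : IsCauchySol n k A f a ⊤ φ) {r : ℝ} (hr : 0 ≤ r) : 0 < φ r :=
  h.2.2.2.2.1 r (IcoE_top ▸ hr)

theorem continuousOn_source (h : IsCauchySol n k A f a ⊤ φ) (hf : Cond109 f) :
    ContinuousOn (fun s => f (φ s) ^ k) (Ici 0) :=
  (hf.1.comp h.continuousOn_Ici fun _ hs => h.pos hs).pow k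

theorem mean_pos (h : IsCauchySol n k A f a ⊤ φ) (hk : 1 ≤ k) (hkn : k ≤ n) (hf : Cond109 f)
    {r : ℝ} (hr : 0 < r) :
    0 < n * r ^ ((k : ℝ) - n) / (n.choose k) *
      ∫ s in (0 : ℝ)..r, s ^ (n - 1) * f (φ s) ^ k := by
  have hn : (0 : ℝ) < n := by exact_mod_cast (by omega : 0 < n)
  have hC : (0 : ℝ) < n.choose k := by exact_mod_cast Nat.choose_pos hkn
  have hJ : 0 < ∫ s in (0 : ℝ)..r, s ^ (n - 1) * f (φ s) ^ k := by
    refine intervalIntegral.intervalIntegral_pos_of_pos_on ?_ (fun s hs => ?_) hr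
    · exact (((continuousOn_pow _).mul (h.continuousOn_source hf)).mono
        fun t ht => (le_inf le_rfl hr.le).trans ht.1).intervalIntegrable
    · have := hf.2.1 _ (h.pos hs.1.le)
      have := hs.1
      positivity
  positivity

theorem deriv_pos (h : IsCauchySol n k A f a ⊤ φ) (hk : 1 ≤ k) (hkn : k ≤ n)
    (hA : Cond103 A) (hf : Cond109 f) {r : ℝ} (hr : 0 < r) : 0 < deriv φ r := by
  have heq := h.2.2.2.2.2 r (IooE_top ▸ hr)
  have hpos := Real.rpow_pos_of_pos (h.mean_pos hk hkn hf hr) ((1 : ℝ) / k)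
  rw [← heq] at hpos
  by_contra! hle
  rcases hle.eq_or_lt with h0 | h0
  · simp [h0] at hpos
  · have := hA.2.1 _ (abs_pos.2 h0.ne)
    nlinarith

theorem flux_pow_eq (h : IsCauchySol n k A f a ⊤ φ) (hk : 1 ≤ k) (hkn : k ≤ n)
    (hA : Cond103 A) (hf : Cond109 f) {r : ℝ} (hr : 0 < r) :
    (deriv φ r * A (deriv φ r)) ^ k = n * r ^ ((k : ℝ) - n) / (n.choose k) *
      ∫ s in (0 : ℝ)..r, s ^ (n - 1) * f (φ s) ^ k := by
  have heq := h.2.2.2.2.2 r (IooE_top ▸ hr)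
  rw [abs_of_pos (h.deriv_pos hk hkn hA hf hr)] at heq
  rw [mul_comm (deriv φ r), heq, one_div,
    Real.rpow_inv_natCast_pow (h.mean_pos hk hkn hf hr).le (by omega)]

theorem strictMonoOn (h : IsCauchySol n k A f a ⊤ φ) (hk : 1 ≤ k) (hkn : k ≤ n)
    (hA : Cond103 A) (hf : Cond109 f) : StrictMonoOn φ (Ici 0) := by
  refine strictMonoOn_of_deriv_pos (convex_Ici 0) h.continuousOn_Ici fun r hr => ?_
  rw [interior_Ici] at hr
  exact h.deriv_pos hk hkn hA hf hr

theorem exists_hasDerivAt_flux_pow (h : IsCauchySol n k A f a ⊤ φ) (hk : 1 ≤ k) (hkn : k ≤ n)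
    (hA : Cond103 A) (hf : Cond109 f) {r : ℝ} (hr : 1 ≤ r) :
    ∃ d, HasDerivAt (fun x => (deriv φ x * A (deriv φ x)) ^ k) d r ∧
      k / (n.choose k : ℝ) * f (φ r) ^ k ≤ d := by
  have hr0 : 0 < r := zero_lt_one.trans_le hr
  have hmono : MonotoneOn (fun s => f (φ s) ^ k) (Ici 0) := fun s hs t ht hst =>
    pow_le_pow_left₀ (hf.2.1 _ (h.pos hs)).le (hf.2.2 (h.pos hs) (h.pos ht)
      ((h.strictMonoOn hk hkn hA hf).monotoneOn hs ht hst)) k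
  obtain ⟨d, hd, hle⟩ := exists_hasDerivAt_weighted_mean hk hkn (h.continuousOn_source hf)
    hmono hr0
  refine ⟨d, hd.congr_of_eventuallyEq ?_, le_trans ?_ hle⟩
  · filter_upwards [Ioi_mem_nhds hr0] with x hx
    exact h.flux_pow_eq hk hkn hA hf hx
  · have := hf.2.1 _ (h.pos hr0.le)
    gcongr
    exact le_mul_of_one_le_left (by positivity) (one_le_pow₀ hr)

theorem deriv_one_le_deriv (h : IsCauchySol n k A f a ⊤ φ) (hk : 1 ≤ k) (hkn : k ≤ n)
    (hA : Cond103 A) (hf : Cond109 f) {r : ℝ} (hr : 1 ≤ r) : deriv φ 1 ≤ deriv φ r := by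
  have hmono : MonotoneOn (fun x => (deriv φ x * A (deriv φ x)) ^ k) (Ici 1) := by
    refine monotoneOn_of_deriv_nonneg (convex_Ici 1) (fun x hx => ?_) (fun x hx => ?_)
      fun x hx => ?_
    · obtain ⟨d, hd, -⟩ := h.exists_hasDerivAt_flux_pow hk hkn hA hf hx
      exact hd.continuousAt.continuousWithinAt
    · obtain ⟨d, hd, -⟩ := h.exists_hasDerivAt_flux_pow hk hkn hA hf (interior_subset hx)
      exact hd.differentiableAt.differentiableWithinAt
    · have hx1 : 1 ≤ x := interior_subset (s := Ici (1 : ℝ)) hx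
      obtain ⟨d, hd, hle⟩ := h.exists_hasDerivAt_flux_pow hk hkn hA hf hx1
      have := hf.2.1 _ (h.pos (zero_le_one.trans hx1))
      rw [hd.deriv]
      exact le_trans (by positivity) hle
  exact ((hA.strictMonoOn_pow hk).le_iff_le (h.deriv_pos hk hkn hA hf one_pos).le
    (h.deriv_pos hk hkn hA hf (one_pos.trans_le hr)).le).1 (hmono self_mem_Ici hr hr)

theorem exists_le (h : IsCauchySol n k A f a ⊤ φ) (hk : 1 ≤ k) (hkn : k ≤ n)
    (hA : Cond103 A) (hf : Cond109 f) (m : ℝ) : ∃ r, 1 ≤ r ∧ m ≤ φ r := by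
  have hδ := h.deriv_pos hk hkn hA hf one_pos
  refine ⟨1 + |m| / deriv φ 1, by simp; positivity, ?_⟩
  have hlin := (convex_Ici (1 : ℝ)).mul_sub_le_image_sub_of_le_deriv
    (h.continuousOn_Ici.mono (Ici_subset_Ici.2 zero_le_one))
    (fun x hx => (h.hasDerivAt (one_pos.trans_le (interior_subset
      (s := Ici (1 : ℝ)) hx))).differentiableAt.differentiableWithinAt)
    (fun x hx => h.deriv_one_le_deriv hk hkn hA hf (interior_subset (s := Ici (1 : ℝ)) hx))
    1 self_mem_Ici (1 + |m| / deriv φ 1) (by simp; positivity) (by simp; positivity)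
  rw [add_sub_cancel_left, mul_div_cancel₀ _ hδ.ne'] at hlin
  have := h.pos zero_le_one
  have := le_abs_self m
  linarith

/-- The energy inequality. -/
theorem integral_le_Psi_deriv (h : IsCauchySol n k A f a ⊤ φ) (hk : 1 ≤ k) (hkn : k ≤ n)
    (hA : Cond103 A) (hf : Cond109 f) {r : ℝ} (hr : 1 ≤ r) :
    (k / (n.choose k : ℝ)) * ∫ t in (φ 1)..(φ r), f t ^ k ≤ Psi A k (deriv φ r) := by
  set E : ℝ → ℝ := fun x => Psi A k (deriv φ x) -
    (k / (n.choose k : ℝ)) * ∫ t in (φ 1)..(φ x), f t ^ k with hE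
  have hderiv : ∀ x ∈ Ici (1 : ℝ), ∃ e, HasDerivAt E e x ∧ 0 ≤ e := by
    intro x hx
    have hx0 : 0 < x := one_pos.trans_le hx
    obtain ⟨d, hd, hle⟩ := h.exists_hasDerivAt_flux_pow hk hkn hA hf hx
    have hφ' := h.deriv_pos hk hkn hA hf hx0
    have hcont : ContinuousAt (deriv φ) x :=
      (IooE_top ▸ h.2.2.1 : ContinuousOn (deriv φ) (Ioi 0)).continuousAt (Ioi_mem_nhds hx0)
    have h1 := hasDerivAt_Psi_comp hA hk hcont (by
      filter_upwards [Ioi_mem_nhds hx0] with y hy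
      exact (h.deriv_pos hk hkn hA hf hy).le) hd
    have hfk : ContinuousOn (fun t => f t ^ k) (Ioi 0) := hf.1.pow k
    have hφx := h.pos hx0.le
    have h2 : HasDerivAt (fun y => ∫ t in (φ 1)..y, f t ^ k) (f (φ x) ^ k) (φ x) :=
      intervalIntegral.integral_hasDerivAt_right
        (hfk.mono fun t ht =>
          (lt_inf_iff.2 ⟨h.pos zero_le_one, hφx⟩).trans_le ht.1).intervalIntegrable
        (hfk.stronglyMeasurableAtFilter isOpen_Ioi _ hφx)
        (hfk.continuousAt (Ioi_mem_nhds hφx))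
    refine ⟨_, h1.sub ((h2.comp x (h.hasDerivAt hx0)).const_mul _), ?_⟩
    nlinarith [mul_le_mul_of_nonneg_left hle hφ'.le]
  have hmono : MonotoneOn E (Ici 1) := by
    refine monotoneOn_of_deriv_nonneg (convex_Ici 1) (fun x hx => ?_) (fun x hx => ?_)
      fun x hx => ?_
    · obtain ⟨d, hd, -⟩ := hderiv x hx
      exact hd.continuousAt.continuousWithinAt
    · obtain ⟨d, hd, -⟩ := hderiv x (interior_subset hx)
      exact hd.differentiableAt.differentiableWithinAt
    · obtain ⟨d, hd, hle⟩ := hderiv x (interior_subset hx)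
      rwa [hd.deriv]
  have hle := hmono self_mem_Ici hr hr
  have hδ := h.deriv_pos hk hkn hA hf one_pos
  have h0 : 0 ≤ Psi A k (deriv φ 1) := by
    have hb := abs_Psi_sub_sub_le hA hk hδ.le le_rfl
    have hB := hA.strictMonoOn_pow hk self_mem_Ici hδ.le hδ
    simp only at hB
    rw [Psi_zero, abs_of_neg (a := _ - (deriv φ 1 * A (deriv φ 1)) ^ k) (by linarith),
      abs_of_neg (a := 0 - deriv φ 1) (by linarith)] at hb
    have := (abs_le.1 hb).2
    nlinarith
  simp only [hE, intervalIntegral.integral_same, mul_zero, sub_zero] at hle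
  linarith

end IsCauchySol

theorem Cond109.intervalIntegrable_pow {f : ℝ → ℝ} (hf : Cond109 f) (k : ℕ) {x y : ℝ}
    (hx : 0 < x) (hy : 0 < y) : IntervalIntegrable (fun t => f t ^ k) volume x y :=
  ((hf.1.pow k).mono fun _ ht => (lt_inf_iff.2 ⟨hx, hy⟩).trans_le ht.1).intervalIntegrable

theorem Cond109.integral_pow_pos {f : ℝ → ℝ} (hf : Cond109 f) (k : ℕ) {x y : ℝ}
    (hx : 0 < x) (hxy : x < y) : 0 < ∫ t in x..y, f t ^ k :=
  intervalIntegral.intervalIntegral_pos_of_pos_on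
    (hf.intervalIntegrable_pow k hx (hx.trans hxy))
    (fun t ht => pow_pos (hf.2.1 t (hx.trans ht.1)) k) hxy

/-- Monotonicity of `f` absorbs a factor `θ ≤ 1` and a change of base point. -/
theorem Cond109.integral_pow_le {f : ℝ → ℝ} (hf : Cond109 f) (k : ℕ) {b c m s θ : ℝ}
    (hb : 0 < b) (hc : 0 < c) (hbm : b ≤ m) (hcm : c ≤ m) (hms : m ≤ s)
    (hθ : 0 < θ) (hθ1 : θ ≤ 1) :
    ∫ t in c..(c + θ * (s - m)), f t ^ k ≤ θ * ∫ t in b..s, f t ^ k := by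
  have hm : 0 < m := hb.trans_le hbm
  have hs : 0 < s := hm.trans_le hms
  have hlin : ∀ t, m ≤ t → 0 < (c - θ * m) + θ * t := fun t ht => by
    nlinarith [mul_nonneg hθ.le (sub_nonneg.2 ht)]
  have hsub := intervalIntegral.smul_integral_comp_add_mul (a := m) (b := s)
    (fun t => f t ^ k) θ (c - θ * m)
  rw [show c - θ * m + θ * m = c by ring,
    show c - θ * m + θ * s = c + θ * (s - m) by ring, smul_eq_mul] at hsub
  rw [← hsub]
  refine mul_le_mul_of_nonneg_left ?_ hθ.le
  have h1 : ∫ t in m..s, f (c - θ * m + θ * t) ^ k ≤ ∫ t in m..s, f t ^ k := by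
    refine intervalIntegral.integral_mono_on hms ?_ (hf.intervalIntegrable_pow k hm hs)
      fun t ht => ?_
    · refine ContinuousOn.intervalIntegrable ?_
      rw [uIcc_of_le hms]
      exact (hf.1.comp (by fun_prop) fun t ht => hlin t ht.1).pow k
    · have := hlin t ht.1
      refine pow_le_pow_left₀ (hf.2.1 _ this).le (hf.2.2 this (hm.trans_le ht.1) ?_) k
      nlinarith [mul_nonneg (sub_nonneg.2 hθ1) (sub_nonneg.2 ht.1)]
  have h2 : 0 ≤ ∫ t in b..m, f t ^ k := by
    refine intervalIntegral.integral_nonneg hbm fun t ht => ?_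
    exact pow_nonneg (hf.2.1 t (hb.trans_le ht.1)).le k
  rw [← intervalIntegral.integral_add_adjacent_intervals
    (hf.intervalIntegrable_pow k hb hm) (hf.intervalIntegrable_pow k hm hs)]
  linarith

/-- Lemma 3.3: a positive global solution of (204) forces
∫_{φ(1)}^∞ (Ψ⁻¹((k/C(n,k))∫_{φ(1)}^s f^k))⁻¹ ds = ∞; hence if (106) holds for some c > 0,
(204) has no positive global solution for any a > 0. -/
theorem global_cauchy_forces_divergence
    (n k : ℕ) (hk : 1 ≤ k) (hkn : k ≤ n) (A f : ℝ → ℝ)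
    (hA : Cond103 A)
    (hinf : Tendsto (fun p => p * A p) atTop atTop)
    (hf : Cond109 f) :
    (∀ a : ℝ, 0 < a → ∀ φ : ℝ → ℝ, IsCauchySol n k A f a ⊤ φ →
      ∫⁻ s in Ioi (φ 1),
        ENNReal.ofReal
          (PsiInv A k ((k / (n.choose k : ℝ)) * ∫ t in (φ 1)..s, f t ^ k))⁻¹ = ⊤) ∧
    ((∃ c : ℝ, 0 < c ∧
        ∫⁻ s in Ioi c, ENNReal.ofReal (PsiInv A k (∫ t in c..s, f t ^ k))⁻¹ ≠ ⊤) →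
      ∀ a : ℝ, 0 < a → ¬ ∃ φ : ℝ → ℝ, IsCauchySol n k A f a ⊤ φ) := by
  have hC : (0 : ℝ) < n.choose k := by exact_mod_cast Nat.choose_pos hkn
  have hk0 : (0 : ℝ) < k := by exact_mod_cast hk
  have hθ : (0 : ℝ) < k / n.choose k := by positivity
  refine ⟨fun a _ φ h => ?_, ?_⟩
  · have hmono := h.strictMonoOn hk hkn hA hf
    have hmem : ∀ r ∈ Ioi (1 : ℝ),
        PsiInv A k ((k / (n.choose k : ℝ)) * ∫ t in (φ 1)..(φ r), f t ^ k) ∈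
          Ioc 0 (deriv φ r) := fun r hr => by
      have hr0 : 0 < r := one_pos.trans hr
      exact PsiInv_mem_Ioc hA hk (h.deriv_pos hk hkn hA hf hr0)
        (mul_pos hθ (hf.integral_pow_pos k (h.pos zero_le_one)
          (hmono (mem_Ici.2 zero_le_one) hr0.le hr)))
        (h.integral_le_Psi_deriv hk hkn hA hf (mem_Ioi.1 hr).le)
    exact lintegral_inv_eq_top_of_le_deriv (y := φ) (y' := deriv φ)
      (g := fun s => PsiInv A k ((k / (n.choose k : ℝ)) * ∫ t in (φ 1)..s, f t ^ k))
      one_pos (fun r hr => h.hasDerivAt (one_pos.trans hr))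
      (hmono.injOn.mono fun r hr => mem_Ici.2 (one_pos.trans hr).le)
      (fun r hr => hmono (mem_Ici.2 zero_le_one) (mem_Ici.2 (one_pos.trans hr).le) hr)
      (fun r hr => (hmem r hr).1) (fun r hr => by simpa using (hmem r hr).2)
  · rintro ⟨c, hc, hfin⟩ a - ⟨φ, h⟩
    have hmono := h.strictMonoOn hk hkn hA hf
    obtain ⟨r₀, hr₀, hm⟩ := h.exists_le hk hkn hA hf (max (φ 1) c)
    set m := max (φ 1) c
    set θ := min ((k : ℝ) / n.choose k) 1
    have hθ0 : 0 < θ := lt_min hθ one_pos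
    have hlt : ∀ r ∈ Ioi r₀, 0 < r ∧ m < φ r := fun r hr => by
      have h0 : 0 < r₀ := one_pos.trans_le hr₀
      exact ⟨h0.trans hr, hm.trans_lt (hmono h0.le (h0.trans hr).le hr)⟩
    have hmaps : ∀ r ∈ Ioi r₀, c < c + θ * (φ r - m) := fun r hr => by
      have := mul_pos hθ0 (sub_pos.2 (hlt r hr).2)
      linarith
    have hmem : ∀ r ∈ Ioi r₀,
        PsiInv A k (∫ t in c..(c + θ * (φ r - m)), f t ^ k) ∈ Ioc 0 (deriv φ r) :=
      fun r hr => by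
      obtain ⟨hr0, hmr⟩ := hlt r hr
      refine PsiInv_mem_Ioc hA hk (h.deriv_pos hk hkn hA hf hr0)
        (hf.integral_pow_pos k hc (hmaps r hr)) ?_
      have hb := h.pos zero_le_one
      refine (hf.integral_pow_le k hb hc (le_max_left _ _) (le_max_right _ _) hmr.le hθ0
        (min_le_right _ _)).trans (le_trans ?_
          (h.integral_le_Psi_deriv hk hkn hA hf (hr₀.trans (mem_Ioi.1 hr).le)))
      exact mul_le_mul_of_nonneg_right (min_le_left _ _)
        (hf.integral_pow_pos k hb ((le_max_left _ _).trans_lt hmr)).le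
    refine hfin (lintegral_inv_eq_top_of_le_deriv (r₀ := r₀)
      (y := fun r => c + θ * (φ r - m)) (y' := fun r => θ * deriv φ r)
      (g := fun s => PsiInv A k (∫ t in c..s, f t ^ k)) hθ0
      (fun r hr => (((h.hasDerivAt (hlt r hr).1).sub_const m).const_mul θ).const_add c)
      (fun r hr s hs hrs => ?_) hmaps (fun r hr => (hmem r hr).1)
      fun r hr => mul_le_mul_of_nonneg_left (hmem r hr).2 hθ0.le)
    refine hmono.injOn (hlt r hr).1.le (hlt s hs).1.le ?_
    simpa [hθ0.ne'] using hrs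
end
end
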